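/- arXiv:2212.12013 — 3 statements merged into one kernel-verified Lean document; each statement's English description precedes it below -/
import Mathlib

section
/- Let p ∈ ℂ[z,w] and let Z(p) ∩ 𝕊₂ denote the set of zeros of p on the unit sphere of ℂ². Then Z(p) ∩ 𝕊₂ is either finite, or it contains the image of a non-constant analytic curve γ : (0,1) → Z(p) ∩ 𝕊₂. -/
section PartA
open Polynomial Topology ContDiff

lemma analytic_evalEval (q : ℝ[X][X]) (u : ℝ × ℝ) :
    AnalyticAt ℝ (fun v : ℝ × ℝ => q.evalEval v.1 v.2) u := by
  induction q using Polynomial.induction_on' with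
  | add p q hp hq => simp only [evalEval_add]; exact hp.add hq
  | monomial n a =>
    have h1 : AnalyticAt ℝ (fun v : ℝ × ℝ => a.eval v.1) u := by
      have := (analyticAt_fst (𝕜 := ℝ) (E := ℝ) (F := ℝ) (p := u)).aeval_polynomial a
      simpa using this
    have := h1.mul ((analyticAt_snd (𝕜 := ℝ) (E := ℝ) (F := ℝ) (p := u)).pow n)
    simpa [Polynomial.evalEval, Polynomial.eval_monomial, Pi.mul_def, Pi.pow_def] using this
  
lemma implicit_poly (q : ℝ[X][X]) (t0 y0 : ℝ) (h0 : q.evalEval t0 y0 = 0)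
    (h1 : (derivative q).evalEval t0 y0 ≠ 0) :
    ∃ φ : ℝ → ℝ, AnalyticAt ℝ φ t0 ∧ ∀ᶠ t in 𝓝 t0, q.evalEval t (φ t) = 0 := by
  set f : ℝ × ℝ → ℝ := fun v => q.evalEval v.1 v.2 with hf
  have hA : ContDiffAt ℝ ω f (t0, y0) := (analytic_evalEval q _).contDiffAt
  have hd : HasDerivAt (fun y => f (t0, y)) ((derivative q).evalEval t0 y0) y0 := by
    have := (q.map (evalRingHom t0)).hasDerivAt y0
    simpa [hf, Polynomial.map_evalRingHom_eval, Polynomial.derivative_map] using this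
  have hi : (fderiv ℝ f (t0, y0) ∘L .inr ℝ ℝ ℝ).IsInvertible := by
    have h2 : HasFDerivAt (fun y => f (t0, y)) (fderiv ℝ f (t0, y0) ∘L .inr ℝ ℝ ℝ) y0 :=
      HasFDerivAt.comp y0 (hA.differentiableAt (by simp)).hasFDerivAt (hasFDerivAt_prodMk_right t0 y0)
    have h3 := h2.hasDerivAt.unique hd
    refine ⟨ContinuousLinearEquiv.unitsEquivAut ℝ (Units.mk0 _ h1), ?_⟩
    ext
    simpa using h3.symm
  refine ⟨hA.implicitFunction (by simp) hi, ?_, ?_⟩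
  · exact (hA.contDiffAt_implicitFunction (by simp) hi).analyticAt
  · have := hA.eventually_apply_implicitFunction (by simp) hi
    simpa [hf, h0] using this
end PartA

section PartB
open Polynomial

lemma primitive_model {D F ι : Type*} [CommRing D] [IsDomain D] [IsIntegrallyClosed D] [CharZero D]
    [Field F] [Algebra D F] [FaithfulSMul D F] [Finite ι] (x : ι → F)
    (hx : ∀ j, IsAlgebraic D (x j)) :
    ∃ (θ : F) (q : D[X]) (d : D) (h : ι → D[X]), d ≠ 0 ∧ aeval θ q = 0 ∧
      aeval θ (derivative q) ≠ 0 ∧ (∀ G : D[X], aeval θ G = 0 → q ∣ G) ∧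
      ∀ j, algebraMap D F d * x j = aeval θ (h j) := by
  classical
  let K := FractionRing D
  let : Algebra K F := FractionRing.liftAlgebra D F
  have : IsScalarTower D K F := FractionRing.isScalarTower_liftAlgebra D F
  have : CharZero K := charZero_of_injective_algebraMap (IsFractionRing.injective D K)
  have hxK : ∀ j, IsIntegral K (x j) := fun j => ((hx j).extendScalars (IsFractionRing.injective D K)).isIntegral
  let L := IntermediateField.adjoin K (Set.range x)
  have : FiniteDimensional K L := IntermediateField.finiteDimensional_adjoin (by
    rintro _ ⟨j, rfl⟩; exact hxK j)
  obtain ⟨α, hα⟩ := Field.exists_primitive_element K L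
  have hαi : IsIntegral K (α : F) := (IsIntegral.of_finite K α).map L.val
  have hαD : IsAlgebraic D (α : F) := (IsFractionRing.isAlgebraic_iff D K F).2 hαi.isAlgebraic
  obtain ⟨y, hy0, hyi⟩ := hαD.exists_integral_multiple
  set θ : F := y • (α : F) with hθ
  have hyF : algebraMap D F y ≠ 0 := by
    rw [Ne, FaithfulSMul.algebraMap_eq_zero_iff]; exact hy0
  have hmem : ∀ j, x j ∈ Algebra.adjoin K {θ} := by
    intro j
    have h1 : x j ∈ IntermediateField.adjoin K {(α : F)} := by
      have h2 : (⟨x j, IntermediateField.subset_adjoin K _ ⟨j, rfl⟩⟩ : L) ∈ IntermediateField.adjoin K {α} := by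
        rw [hα]; trivial
      have h3 := (IntermediateField.mem_map (f := L.val) _).2 ⟨_, h2, rfl⟩
      rw [IntermediateField.adjoin_map] at h3
      simpa using h3
    rw [← IntermediateField.mem_toSubalgebra, IntermediateField.adjoin_simple_toSubalgebra_of_isAlgebraic hαi.isAlgebraic] at h1
    refine (Algebra.adjoin_le ?_ : Algebra.adjoin K {(α : F)} ≤ Algebra.adjoin K {θ}) h1
    rintro _ rfl
    have : (α : F) = (algebraMap D K y)⁻¹ • θ := by
      rw [hθ, Algebra.smul_def, Algebra.smul_def, map_inv₀, ← IsScalarTower.algebraMap_apply]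
      field_simp
    rw [this]
    exact Subalgebra.smul_mem _ (Algebra.self_mem_adjoin_singleton K θ) _
  have hpol : ∀ j, ∃ g : K[X], aeval θ g = x j := fun j => by
    have := hmem j
    rw [Algebra.adjoin_singleton_eq_range_aeval] at this
    exact this
  choose g hg using hpol
  have hclear : ∀ j, ∃ b : D, b ≠ 0 ∧ ∃ h : D[X], algebraMap D F b * x j = aeval θ h := by
    intro j
    obtain ⟨b, hbm, hb⟩ := IsLocalization.integerNormalization_spec (nonZeroDivisors D) (g j)
    refine ⟨b, nonZeroDivisors.ne_zero hbm, IsLocalization.integerNormalization (nonZeroDivisors D) (g j), ?_⟩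
    have h5 := (aeval θ : K[X] →ₐ[K] F).toLinearMap.map_smul_of_tower b (g j)
    rw [AlgHom.toLinearMap_apply, AlgHom.toLinearMap_apply, hg j] at h5
    rw [← aeval_map_algebraMap K, hb, h5, Algebra.smul_def]
  choose b hb0 h hbh using hclear
  have := Fintype.ofFinite ι
  have hm0 : minpoly D θ ≠ 0 := minpoly.ne_zero hyi
  refine ⟨θ, minpoly D θ, ∏ j, b j, fun j => C (∏ i ∈ Finset.univ.erase j, b i) * h j,
    Finset.prod_ne_zero_iff.2 fun j _ => hb0 j, minpoly.aeval _ _, ?_,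
    fun G hG => minpoly.isIntegrallyClosed_dvd hyi hG, ?_⟩
  · intro h0
    have hpos := minpoly.natDegree_pos hyi
    have hne : derivative (minpoly D θ) ≠ 0 := by
      intro h
      have := derivative_eq_zero.1 h
      omega
    have := minpoly.IsIntegrallyClosed.degree_le_of_ne_zero hne h0
    exact absurd this (not_le.2 (degree_derivative_lt hm0))
  · intro j
    simp only [map_mul, aeval_C]
    rw [← hbh, ← Finset.prod_erase_mul _ _ (Finset.mem_univ j), map_mul]
    ring

/-- Transfer of polynomial relations. -/
lemma transfer {R0 E1 E2 ι : Type*} [CommRing R0] [CommRing E1] [CommRing E2]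
    [Algebra ℝ R0] [Algebra ℝ E1] [Algebra ℝ E2] (α : R0 →ₐ[ℝ] E1) (β : R0 →ₐ[ℝ] E2)
    (hk : ∀ G, α G = 0 → β G = 0) (d : R0) (hd : IsUnit (β d)) (h : ι → R0)
    (a : ι → E1) (b : ι → E2) (ha : ∀ j, α d * a j = α (h j)) (hb : ∀ j, β d * b j = β (h j))
    (f : MvPolynomial ι ℝ) (hf : MvPolynomial.aeval a f = 0) : MvPolynomial.aeval b f = 0 := by
  have key : ∃ (N : ℕ) (G : R0), α d ^ N * MvPolynomial.aeval a f = α G ∧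
      β d ^ N * MvPolynomial.aeval b f = β G := by
    clear hf
    induction f using MvPolynomial.induction_on with
    | C c => exact ⟨0, algebraMap ℝ R0 c, by simp, by simp⟩
    | add f g hf hg =>
      obtain ⟨N, G, h1, h2⟩ := hf
      obtain ⟨M, H, h3, h4⟩ := hg
      refine ⟨N + M, d ^ M * G + d ^ N * H, ?_, ?_⟩
      · simp only [map_add, map_mul, map_pow, ← h1, ← h3]; ring
      · simp only [map_add, map_mul, map_pow, ← h2, ← h4]; ring
    | mul_X f j hf =>
      obtain ⟨N, G, h1, h2⟩ := hf
      refine ⟨N + 1, G * h j, ?_, ?_⟩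
      · simp only [map_mul, ← h1, ← ha, MvPolynomial.aeval_X]; ring
      · simp only [map_mul, ← h2, ← hb, MvPolynomial.aeval_X]; ring
  obtain ⟨N, G, h1, h2⟩ := key
  rw [hf, mul_zero] at h1
  rw [hk G h1.symm] at h2
  exact (hd.pow N).mul_right_eq_zero.1 h2
end PartB

section PartC
open Polynomial

variable {k E : Type*} [Field k] [Field E] [Algebra k E]

/-- algebraic dependence of `w` over `k(z)` -/
def DepOn (k : Type*) {E : Type*} [Field k] [Field E] [Algebra k E] (z w : E) : Prop :=
  IsAlgebraic (Algebra.adjoin k {z}) w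

lemma aevalAeval_eq_eval₂ (z w : E) (P : k[X][X]) :
    aevalAeval z w P = P.eval₂ (aeval z : k[X] →ₐ[k] E).toRingHom w := by
  induction P using Polynomial.induction_on' with
  | add p q hp hq => rw [map_add, eval₂_add, hp, hq]
  | monomial n a => simp [← C_mul_X_pow_eq_monomial]

lemma exists_adjoinMap (k : Type*) {E : Type*} [Field k] [Field E] [Algebra k E] (z : E) :
    ∃ φ : k[X] →+* Algebra.adjoin k {z}, Function.Surjective φ ∧
      (algebraMap (Algebra.adjoin k {z}) E).comp φ = (aeval z : k[X] →ₐ[k] E).toRingHom := by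
  let φ : k[X] →ₐ[k] Algebra.adjoin k {z} :=
    aeval (⟨z, Algebra.self_mem_adjoin_singleton k z⟩ : Algebra.adjoin k {z})
  have hφ : (Algebra.adjoin k {z}).val.comp φ = aeval z := by
    ext
    simp [φ]
  have hφ' : ∀ f, ((φ f : Algebra.adjoin k {z}) : E) = aeval z f := fun f => DFunLike.congr_fun hφ f
  refine ⟨φ.toRingHom, ?_, RingHom.ext hφ'⟩
  rintro ⟨c, hc⟩
  have hc' := hc
  rw [Algebra.adjoin_singleton_eq_range_aeval] at hc'
  obtain ⟨f, hf⟩ := hc'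
  exact ⟨f, Subtype.ext ((hφ' f).trans hf)⟩

lemma depOn_of_relation {z w : E} (hz : Transcendental k z) {P : k[X][X]} (hP : P ≠ 0)
    (h : aevalAeval z w P = 0) : DepOn k z w := by
  obtain ⟨φ, -, hφ⟩ := exists_adjoinMap k z
  have hinj : Function.Injective φ := by
    rw [injective_iff_map_eq_zero]
    intro f hf
    have h1 := RingHom.congr_fun hφ f
    rw [RingHom.comp_apply, hf, map_zero] at h1
    exact (transcendental_iff.1 hz) f h1.symm
  refine ⟨P.map φ, (Polynomial.map_ne_zero_iff hinj).2 hP, ?_⟩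
  rw [aevalAeval_eq_eval₂] at h
  rw [aeval_def, eval₂_map, hφ, h]

lemma relation_of_depOn {z w : E} (h : DepOn k z w) :
    ∃ P : k[X][X], P ≠ 0 ∧ aevalAeval z w P = 0 := by
  obtain ⟨p, hp0, hp⟩ := h
  obtain ⟨φ, hs, hφ⟩ := exists_adjoinMap k z
  obtain ⟨P, rfl⟩ := Polynomial.map_surjective φ hs p
  refine ⟨P, fun h => hp0 (by rw [h, Polynomial.map_zero]), ?_⟩
  rw [aeval_def, eval₂_map, hφ] at hp
  rw [aevalAeval_eq_eval₂, hp]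

lemma DepOn.trans {x y z : E} (h1 : DepOn k x y) (h2 : DepOn k y z) : DepOn k x z := by
  refine IsAlgebraic.adjoin_of_forall_isAlgebraic ?_ h2
  rintro _ ⟨rfl, _⟩
  exact h1

lemma DepOn.exchange {x y : E} (h1 : DepOn k x y) (hy : Transcendental k y) : DepOn k y x := by
  obtain ⟨P, hP, h⟩ := relation_of_depOn h1
  refine depOn_of_relation hy (P := Bivariate.swap P) ?_ ?_
  · simpa using hP
  · rw [Bivariate.aevalAeval_swap, h]

lemma transcendental_of_notMem [IsAlgClosed k] {z : E} (hz : z ∉ Set.range (algebraMap k E)) :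
    Transcendental k z := by
  intro h
  apply hz
  have h1 : IsIntegral k z := h.isIntegral
  have h2 := IsAlgClosed.degree_eq_one_of_irreducible k (minpoly.irreducible h1)
  exact minpoly.mem_range_of_degree_eq_one k z h2

lemma line_argument [IsAlgClosed k] {z w a b : E} (hz : z ∉ Set.range (algebraMap k E))
    {P : k[X][X]} (hP : P ≠ 0) (hw : DepOn k z w) (h : aevalAeval a b P = 0)
    (hl : z * a + w * b = 1) : DepOn k z a := by
  classical
  by_contra ha
  let A := IntermediateField.adjoin k {z}
  let L := algebraicClosure A E
  have : IsScalarTower k L E := IsScalarTower.of_algebraMap_eq fun _ => rfl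
  have haA : Transcendental A a := fun h => ha (IntermediateField.isAlgebraic_adjoin_iff.1 h)
  have hwA : IsAlgebraic A w := IntermediateField.isAlgebraic_adjoin_iff.2 hw
  have haL : Transcendental L a := haA.algebraicClosure
  have hwL : w ∈ L := mem_algebraicClosure_iff.2 hwA
  have hzL : z ∈ L := 
    L.algebraMap_mem (⟨z, IntermediateField.mem_adjoin_simple_self k z⟩ : A)
  have hw0 : w ≠ 0 := by
    rintro rfl
    apply haL
    have : a = z⁻¹ := by
      rw [zero_mul, add_zero] at hl
      exact eq_inv_of_mul_eq_one_right hl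
    rw [this]
    exact isAlgebraic_algebraMap (⟨z⁻¹, L.inv_mem hzL⟩ : L)
  let β : L := ⟨w, hwL⟩⁻¹
  let c : L := - (⟨z, hzL⟩ * β)
  have hβ : (β : E) = w⁻¹ := rfl
  have hc : (c : E) = - (z * w⁻¹) := rfl
  have hb : b = β + c * a := by
    rw [hβ, hc]; field_simp; linear_combination hl
  have hR : aevalAeval (A := L[X]) X (C β + C c * X) P = 0 := by
    refine (transcendental_iff.1 haL) _ ?_
    have : ((aeval a : L[X] →ₐ[L] E).restrictScalars k).comp (aevalAeval (A := L[X]) X (C β + C c * X))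
        = (aevalAeval a b : k[X][X] →ₐ[k] E) := by
      ext <;> simp [hb]
    have h2 := DFunLike.congr_fun this P
    rw [h] at h2
    exact h2
  have hE : ∀ t : k, aevalAeval (algebraMap k E t) ((β : E) + c * algebraMap k E t) P = 0 := by
    intro t
    have : ((aeval (algebraMap k E t) : L[X] →ₐ[L] E).restrictScalars k).comp (aevalAeval (A := L[X]) X (C β + C c * X))
        = (aevalAeval (algebraMap k E t) ((β : E) + c * algebraMap k E t) : k[X][X] →ₐ[k] E) := by
      ext <;> simp
    have h2 := DFunLike.congr_fun this P
    rw [← h2]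
    simp [hR]
  obtain ⟨i, hi⟩ := Polynomial.nonempty_support_iff.2 hP
  have hi0 : P.coeff i ≠ 0 := Polynomial.mem_support_iff.1 hi
  have hmem : ∀ t : k, (P.coeff i).eval t ≠ 0 → ∃ m : k, algebraMap k E m = (β : E) + c * algebraMap k E t := by
    intro t ht
    by_contra hne
    have htr : Transcendental k ((β : E) + c * algebraMap k E t) := transcendental_of_notMem hne
    have h0 : P.map (evalRingHom t) = 0 := by
      refine (transcendental_iff.1 htr) _ ?_
      rw [← hE t, aevalAeval_eq_eval₂, aeval_def, eval₂_map]
      congr 1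
      ext <;> simp
    apply ht
    have := congrArg (fun q => q.coeff i) h0
    simpa using this
  have hinf : (((P.coeff i).roots.toFinset : Set k)ᶜ).Infinite := (Finset.finite_toSet _).infinite_compl
  obtain ⟨t1, ht1⟩ := hinf.nonempty
  obtain ⟨t2, ht2, ht12⟩ := hinf.exists_notMem_finite (Set.finite_singleton t1)
  obtain ⟨m1, hm1⟩ := hmem t1 (by simpa [hi0] using ht1)
  obtain ⟨m2, hm2⟩ := hmem t2 (by simpa [hi0] using ht2)
  have h12 : algebraMap k E t2 - algebraMap k E t1 ≠ 0 := by
    rw [sub_ne_zero]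
    exact fun h => ht12 ((algebraMap k E).injective h)
  have hcE : (c : E) = algebraMap k E ((m2 - m1) / (t2 - t1)) := by
    rw [map_div₀, map_sub, map_sub, eq_div_iff h12]
    linear_combination hm1 - hm2
  have hβE : (β : E) = algebraMap k E (m1 - (m2 - m1) / (t2 - t1) * t1) := by
    rw [map_sub, map_mul, ← hcE, hm1]; ring
  apply hz
  refine ⟨- ((m2 - m1) / (t2 - t1)) / (m1 - (m2 - m1) / (t2 - t1) * t1), ?_⟩
  rw [map_div₀, map_neg, ← hcE, ← hβE, hc, hβ]
  field_simp
end PartC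

section PartD
open Polynomial Filter Topology

lemma exists_ultra {ι : Type} (U : Ultrafilter ι) (R : Type) [Field R] :
    ∃ (F : Type) (_ : Field F) (_ : Algebra R F) (π : (ι → R) →ₐ[R] F), Function.Surjective π ∧
      ∀ f, π f = 0 ↔ ∀ᶠ s in (U : Filter ι), f s = 0 := by
  let i : R →+* Germ (U : Filter ι) R :=
    (Germ.coeRingHom (U : Filter ι)).comp (Pi.constRingHom ι R)
  let alg : Algebra R (Germ (U : Filter ι) R) := i.toAlgebra
  refine ⟨Germ (U : Filter ι) R, inferInstance, alg,
    { Germ.coeRingHom (U : Filter ι) with commutes' := fun c => rfl }, ?_, ?_⟩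
  · intro f
    exact Germ.inductionOn f fun g => ⟨g, rfl⟩
  · intro f
    exact Germ.coe_eq

lemma los_biv {ι R F : Type} [Field R] [Field F] [Algebra R F] (π : (ι → R) →ₐ[R] F)
    (f g : ι → R) (P : R[X][X]) :
    aevalAeval (π f) (π g) P = π (fun s => P.evalEval (f s) (g s)) := by
  have h1 : π.comp (aevalAeval f g) = aevalAeval (π f) (π g) := by
    ext <;> simp
  rw [← h1, AlgHom.comp_apply]
  congr 1
  funext s
  have h2 : (Pi.evalAlgHom R (fun _ : ι => R) s).comp (aevalAeval f g) = aevalAeval (f s) (g s) := by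
    ext <;> simp
  rw [← coe_aevalAeval_eq_evalEval, ← h2]
  rfl

lemma los_mv {ι σ R F : Type} [Field R] [Field F] [Algebra R F] (π : (ι → R) →ₐ[R] F)
    (f : σ → ι → R) (P : MvPolynomial σ R) :
    MvPolynomial.aeval (fun j => π (f j)) P = π (fun s => MvPolynomial.eval (fun j => f j s) P) := by
  have h1 : π.comp (MvPolynomial.aeval f) = MvPolynomial.aeval (fun j => π (f j)) := by
    ext; simp
  rw [← h1, AlgHom.comp_apply]
  congr 1
  funext s
  have h2 : (Pi.evalAlgHom R (fun _ : ι => R) s).comp (MvPolynomial.aeval f) =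
      MvPolynomial.aeval (fun j => f j s) := by
    ext; simp
  rw [← MvPolynomial.coe_aeval_eq_eval]
  exact DFunLike.congr_fun h2 P

lemma eventually_const_of_root {ι R : Type} [Field R] (U : Ultrafilter ι) (f : ι → R) (P : R[X])
    (hP : P ≠ 0) (h : ∀ᶠ s in (U : Filter ι), P.eval (f s) = 0) :
    ∃ c, ∀ᶠ s in (U : Filter ι), f s = c := by
  classical
  have h2 : (⋃ c ∈ (P.roots.toFinset : Set R), {s | f s = c}) ∈ U := by
    filter_upwards [h] with s hs
    simp [hP, hs]
  rw [Ultrafilter.finite_biUnion_mem_iff (Finset.finite_toSet _)] at h2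
  obtain ⟨c, -, hc⟩ := h2
  exact ⟨c, hc⟩

lemma real_curve {ι : Type} (U : Ultrafilter ι) (x : Fin 4 → ι → ℝ) (j0 : Fin 4)
    (hnc : ∀ c, ¬ ∀ᶠ s in (U : Filter ι), x j0 s = c)
    (hQ : ∀ j, ∃ Q : ℝ[X][X], Q ≠ 0 ∧ ∀ᶠ s in (U : Filter ι), Q.evalEval (x j0 s) (x j s) = 0) :
    ∃ (c : Fin 4 → ℝ → ℝ) (t0 : ℝ), (∀ j, AnalyticAt ℝ (c j) t0) ∧
      ∀ᶠ t in 𝓝 t0, c j0 t = t ∧ ∀ f : MvPolynomial (Fin 4) ℝ,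
        (∀ s, MvPolynomial.eval (fun j => x j s) f = 0) → MvPolynomial.eval (fun j => c j t) f = 0 := by
  obtain ⟨F, _, _, π, hs, hπ⟩ := exists_ultra U ℝ
  set r : F := π (x j0) with hr
  have hrt : Transcendental ℝ r := by
    rw [transcendental_iff]
    intro P hP
    by_contra hP0
    have h1 : aevalAeval r r (C P : ℝ[X][X]) = 0 := by rw [aevalAeval_C, hP]
    rw [hr, los_biv, hπ] at h1
    obtain ⟨c, hc⟩ := eventually_const_of_root U (x j0) P hP0 (by simpa only [evalEval_C] using h1)
    exact hnc c hc
  let algX : Algebra ℝ[X] F := (aeval r : ℝ[X] →ₐ[ℝ] F).toRingHom.toAlgebra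
  have hinj : Function.Injective (algebraMap ℝ[X] F) := by
    rw [injective_iff_map_eq_zero]
    exact fun f hf => transcendental_iff.1 hrt f hf
  have : FaithfulSMul ℝ[X] F := (faithfulSMul_iff_algebraMap_injective _ _).2 hinj
  have hev : ∀ (θ : F) (G : ℝ[X][X]), aeval θ G = aevalAeval r θ G := by
    intro θ G
    rw [aevalAeval_eq_eval₂]; rfl
  have halg : ∀ j, IsAlgebraic ℝ[X] (π (x j)) := by
    intro j
    obtain ⟨Q, hQ0, hQ⟩ := hQ j
    refine ⟨Q, hQ0, ?_⟩
    rw [hev, los_biv, hπ]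
    exact hQ
  obtain ⟨θ, q, d, h, hd, hq, hq', hdvd, hh⟩ := primitive_model (fun j => π (x j)) halg
  obtain ⟨θ0, rfl⟩ := hs θ
  have e1 : ∀ᶠ s in (U : Filter ι), q.evalEval (x j0 s) (θ0 s) = 0 := by
    rwa [hev, los_biv, hπ] at hq
  have e2 : ∀ᶠ s in (U : Filter ι), (derivative q).evalEval (x j0 s) (θ0 s) ≠ 0 := by
    rw [Ne, hev, los_biv, hπ] at hq'
    exact Ultrafilter.eventually_not.2 hq'
  have e3 : ∀ᶠ s in (U : Filter ι), d.eval (x j0 s) ≠ 0 := by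
    refine Ultrafilter.eventually_not.2 fun h3 => ?_
    obtain ⟨c, hc⟩ := eventually_const_of_root U (x j0) d hd h3
    exact hnc c hc
  obtain ⟨s, h1, h2, h3⟩ := (e1.and (e2.and e3)).exists
  obtain ⟨φ, hφ, hφq⟩ := implicit_poly q (x j0 s) (θ0 s) h1 h2
  have hdA : AnalyticAt ℝ (fun t => d.eval t) (x j0 s) := by
    simpa using (analyticAt_id (𝕜 := ℝ) (z := x j0 s)).aeval_polynomial d
  have hdne : ∀ᶠ t in 𝓝 (x j0 s), d.eval t ≠ 0 := hdA.continuousAt.eventually_ne h3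
  refine ⟨fun j t => (h j).evalEval t (φ t) / d.eval t, x j0 s, ?_, ?_⟩
  · intro j
    refine AnalyticAt.div ?_ hdA h3
    exact (analytic_evalEval (h j) (x j0 s, φ (x j0 s))).comp (f := fun t => (t, φ t)) (analyticAt_id.prod hφ)
  · filter_upwards [hφq, hdne] with t ht hdt
    have hker : ∀ G : ℝ[X][X], aevalAeval r (π θ0) G = 0 → aevalAeval t (φ t) G = 0 := by
      intro G hG
      rw [← hev] at hG
      obtain ⟨H, rfl⟩ := hdvd G hG
      rw [map_mul, coe_aevalAeval_eq_evalEval, ht, zero_mul]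
    have hh' : ∀ j, aevalAeval r (π θ0) (C d : ℝ[X][X]) * π (x j) = aevalAeval r (π θ0) (h j) := by
      intro j
      rw [← hev, ← hev, ← hh j]
      simp
    constructor
    · have h5 := hker (C d * C X - h j0) (by
        rw [map_sub, map_mul, ← hh' j0, aevalAeval_X, sub_self])
      rw [map_sub, map_mul, aevalAeval_X, aevalAeval_C, coe_aevalAeval_eq_evalEval, coe_aeval_eq_eval,
        sub_eq_zero] at h5
      rw [div_eq_iff hdt, ← h5, mul_comm]
    · intro f hf
      rw [← MvPolynomial.coe_aeval_eq_eval]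
      refine transfer (aevalAeval r (π θ0)) (aevalAeval t (φ t)) hker (C d) ?_ h (fun j => π (x j)) _ hh' ?_ f ?_
      · rw [aevalAeval_C, coe_aeval_eq_eval]
        exact hdt.isUnit
      · intro j
        rw [aevalAeval_C, coe_aeval_eq_eval, coe_aevalAeval_eq_evalEval, mul_div_cancel₀ _ hdt]
      · rw [los_mv]
        simp only [hf]
        exact map_zero π

lemma split_poly (q : ℂ[X]) : ∃ a b : ℝ[X],
    q = a.map Complex.ofRealHom + C Complex.I * b.map Complex.ofRealHom := by
  induction q using Polynomial.induction_on' with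
  | add p q hp hq =>
    obtain ⟨a, b, rfl⟩ := hp
    obtain ⟨a', b', rfl⟩ := hq
    exact ⟨a + a', b + b', by simp only [Polynomial.map_add]; ring⟩
  | monomial n z =>
    refine ⟨monomial n z.re, monomial n z.im, ?_⟩
    simp only [map_monomial, C_mul_monomial, ← map_add]
    congr 1
    simp [mul_comm Complex.I, Complex.re_add_im]

lemma split_poly₂ (q : ℂ[X][X]) : ∃ a b : ℝ[X][X],
    q = a.map (mapRingHom Complex.ofRealHom) + C (C Complex.I) * b.map (mapRingHom Complex.ofRealHom) := by
  induction q using Polynomial.induction_on' with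
  | add p q hp hq =>
    obtain ⟨a, b, rfl⟩ := hp
    obtain ⟨a', b', rfl⟩ := hq
    exact ⟨a + a', b + b', by simp only [Polynomial.map_add]; ring⟩
  | monomial n z =>
    obtain ⟨a, b, rfl⟩ := split_poly z
    refine ⟨monomial n a, monomial n b, ?_⟩
    simp only [map_monomial, C_mul_monomial, ← map_add]
    rfl

lemma real_relation (Q : ℂ[X][X]) (hQ : Q ≠ 0) : ∃ Q1 : ℝ[X][X], Q1 ≠ 0 ∧
    ∀ x y : ℝ, Q.evalEval (x : ℂ) (y : ℂ) = 0 → Q1.evalEval x y = 0 := by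
  obtain ⟨a, b, rfl⟩ := split_poly₂ Q
  have key : ∀ x y : ℝ, (a.map (mapRingHom Complex.ofRealHom) +
      C (C Complex.I) * b.map (mapRingHom Complex.ofRealHom)).evalEval (x : ℂ) (y : ℂ) = 0 →
      a.evalEval x y = 0 ∧ b.evalEval x y = 0 := by
    intro x y h
    have ha := map_mapRingHom_evalEval Complex.ofRealHom a x y
    have hb := map_mapRingHom_evalEval Complex.ofRealHom b x y
    simp only [Complex.ofRealHom_eq_coe] at ha hb
    rw [evalEval_add, evalEval_mul, ha, hb, evalEval_C, eval_C] at h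
    have h1 := congrArg Complex.re h
    have h2 := congrArg Complex.im h
    simp at h1 h2
    exact ⟨h1, h2⟩
  by_cases ha : a = 0
  · refine ⟨b, ?_, fun x y h => (key x y h).2⟩
    rintro rfl
    simp [ha] at hQ
  · exact ⟨a, ha, fun x y h => (key x y h).1⟩

lemma split_mv (p : MvPolynomial (Fin 2) ℂ) : ∃ a b : MvPolynomial (Fin 4) ℝ, ∀ x : Fin 4 → ℝ,
    MvPolynomial.eval ![(x 0 : ℂ) + x 1 * Complex.I, (x 2 : ℂ) + x 3 * Complex.I] p =
      (MvPolynomial.eval x a : ℂ) + MvPolynomial.eval x b * Complex.I := by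
  induction p using MvPolynomial.induction_on with
  | C c => exact ⟨MvPolynomial.C c.re, MvPolynomial.C c.im, fun x => by simp⟩
  | add p q hp hq =>
    obtain ⟨a, b, h⟩ := hp
    obtain ⟨a', b', h'⟩ := hq
    refine ⟨a + a', b + b', fun x => ?_⟩
    simp only [map_add, h, h']
    push_cast
    ring
  | mul_X p j hp =>
    obtain ⟨a, b, h⟩ := hp
    fin_cases j
    · refine ⟨a * MvPolynomial.X 0 - b * MvPolynomial.X 1, a * MvPolynomial.X 1 + b * MvPolynomial.X 0, fun x => ?_⟩
      simp [h]
      linear_combination ((MvPolynomial.eval x b) * (x 1) : ℂ) * Complex.I_sq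
    · refine ⟨a * MvPolynomial.X 2 - b * MvPolynomial.X 3, a * MvPolynomial.X 3 + b * MvPolynomial.X 2, fun x => ?_⟩
      simp [h]
      linear_combination ((MvPolynomial.eval x b) * (x 3) : ℂ) * Complex.I_sq
end PartD

section PartE
open Polynomial Filter Topology

/-- The four real coordinate functions. -/
def coordSet {ι : Type} (z w : ι → ℂ) : Set (ι → ℝ) :=
  {fun s => (z s).re, fun s => (z s).im, fun s => (w s).re, fun s => (w s).im}

lemma DepOn.lin {k E : Type} [Field k] [Field E] [Algebra k E] {z a b : E} (ha : DepOn k z a)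
    (hb : DepOn k z b) (c d : k) : DepOn k z (algebraMap k E c * a + algebraMap k E d * b) := by
  have h : ∀ c : k, IsAlgebraic (Algebra.adjoin k {z}) (algebraMap k E c) := fun c =>
    isAlgebraic_algebraMap (algebraMap k (Algebra.adjoin k {z}) c)
  exact ((h c).mul ha).add ((h d).mul hb)

lemma complex_dep {ι : Type} (U : Ultrafilter ι) (z w : ι → ℂ) (P : ℂ[X][X]) (hP0 : P ≠ 0)
    (hP : ∀ s, P.evalEval (z s) (w s) = 0) (hS : ∀ s, ‖z s‖ ^ 2 + ‖w s‖ ^ 2 = 1)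
    (hz : ∀ c, ¬ ∀ᶠ s in (U : Filter ι), z s = c) (x y : ι → ℝ) (hx : x ∈ coordSet z w)
    (hy : y ∈ coordSet z w) (hxn : ∀ c, ¬ ∀ᶠ s in (U : Filter ι), x s = c) :
    ∃ Q : ℝ[X][X], Q ≠ 0 ∧ ∀ᶠ s in (U : Filter ι), Q.evalEval (x s) (y s) = 0 := by
  obtain ⟨F, _, _, π, -, hπ⟩ := exists_ultra U ℂ
  have hrange : ∀ f : ι → ℂ, (∀ c, ¬ ∀ᶠ s in (U : Filter ι), f s = c) →
      π f ∉ Set.range (algebraMap ℂ F) := by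
    rintro f hf ⟨c, hc⟩
    rw [← π.commutes c, eq_comm, ← sub_eq_zero, ← map_sub, hπ] at hc
    refine hf c (hc.mono fun s hs => ?_)
    simpa [sub_eq_zero] using hs
  set Z := π z
  set W := π w
  set A := π (fun s => starRingEnd ℂ (z s)) with hA
  set B := π (fun s => starRingEnd ℂ (w s)) with hB
  have hZr : Z ∉ Set.range (algebraMap ℂ F) := hrange z hz
  have hAr : A ∉ Set.range (algebraMap ℂ F) := by
    refine hrange _ fun c hc => hz (starRingEnd ℂ c) (hc.mono fun s hs => ?_)
    rw [← hs]; simp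
  have hZW : aevalAeval Z W P = 0 := by
    rw [los_biv]; simp only [hP]; exact map_zero π
  set P' : ℂ[X][X] := P.map (mapRingHom (starRingEnd ℂ)) with hP'
  have hP'0 : P' ≠ 0 := by
    rw [hP', Polynomial.map_ne_zero_iff]
    · exact hP0
    · exact Polynomial.map_injective _ (starRingEnd ℂ).injective
  have hAB : aevalAeval A B P' = 0 := by
    rw [los_biv]
    have : ∀ s, P'.evalEval (starRingEnd ℂ (z s)) (starRingEnd ℂ (w s)) = 0 := fun s => by
      rw [hP', map_mapRingHom_evalEval, hP s, map_zero]
    simp only [this]; exact map_zero π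
  have hl : Z * A + W * B = 1 := by
    rw [hA, hB, ← map_mul, ← map_mul, ← map_add, ← map_one π]
    congr 1
    funext s
    have := hS s
    simp only [Pi.add_apply, Pi.mul_apply, Pi.one_apply, Complex.mul_conj, Complex.normSq_eq_norm_sq]
    exact_mod_cast this
  have dW : DepOn ℂ Z W := depOn_of_relation (transcendental_of_notMem hZr) hP0 hZW
  have dA : DepOn ℂ Z A := line_argument hZr hP'0 dW hAB hl
  have dB : DepOn ℂ Z B := dA.trans (depOn_of_relation (transcendental_of_notMem hAr) hP'0 hAB)
  have dZ : DepOn ℂ Z Z :=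
    isAlgebraic_algebraMap (⟨Z, Algebra.self_mem_adjoin_singleton ℂ Z⟩ : Algebra.adjoin ℂ {Z})
  have hre : ∀ f : ι → ℂ, π (fun s => ((f s).re : ℂ)) = algebraMap ℂ F (1 / 2) * π f +
      algebraMap ℂ F (1 / 2) * π (fun s => starRingEnd ℂ (f s)) := by
    intro f
    rw [← π.commutes, ← map_mul, ← map_mul, ← map_add]
    congr 1
    funext s
    simp [Complex.re_eq_add_conj]
    ring
  have him : ∀ f : ι → ℂ, π (fun s => ((f s).im : ℂ)) = algebraMap ℂ F (1 / (2 * Complex.I)) * π f +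
      algebraMap ℂ F (- (1 / (2 * Complex.I))) * π (fun s => starRingEnd ℂ (f s)) := by
    intro f
    rw [← π.commutes, ← π.commutes, ← map_mul, ← map_mul, ← map_add]
    congr 1
    funext s
    simp [Complex.im_eq_sub_conj]
    ring_nf
    rw [Complex.inv_I]
    ring
  have hdep : ∀ v ∈ coordSet z w, DepOn ℂ Z (π (fun s => (v s : ℂ))) := by
    rintro v (rfl | rfl | rfl | rfl)
    · rw [hre]; exact dZ.lin dA _ _
    · rw [him]; exact dZ.lin dA _ _
    · rw [hre]; exact dW.lin dB _ _
    · rw [him]; exact dW.lin dB _ _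
  have hxr : π (fun s => (x s : ℂ)) ∉ Set.range (algebraMap ℂ F) := by
    refine hrange _ fun c hc => hxn c.re (hc.mono fun s hs => ?_)
    rw [← hs]; simp
  have hfin := ((hdep x hx).exchange (transcendental_of_notMem hxr)).trans (hdep y hy)
  obtain ⟨Q, hQ0, hQ⟩ := relation_of_depOn hfin
  obtain ⟨Q1, h1, h2⟩ := real_relation Q hQ0
  refine ⟨Q1, h1, ?_⟩
  rw [los_biv, hπ] at hQ
  exact hQ.mono fun s hs => h2 _ _ hs

lemma complex_nonconst {ι : Type} (U : Ultrafilter ι) (z : ι → ℂ)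
    (hz : ∀ c, ¬ ∀ᶠ s in (U : Filter ι), z s = c) :
    (∀ c, ¬ ∀ᶠ s in (U : Filter ι), (z s).re = c) ∨ (∀ c, ¬ ∀ᶠ s in (U : Filter ι), (z s).im = c) := by
  by_contra! h
  obtain ⟨⟨a, ha⟩, ⟨b, hb⟩⟩ := h
  refine hz ⟨a, b⟩ ?_
  filter_upwards [ha, hb] with s h1 h2
  exact Complex.ext h1 h2

lemma biv_of_mv (p : MvPolynomial (Fin 2) ℂ) (hp : p ≠ 0) :
    ∃ P : ℂ[X][X], P ≠ 0 ∧ ∀ z w, P.evalEval z w = MvPolynomial.eval ![z, w] p := by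
  refine ⟨(Bivariate.equivMvPolynomial ℂ).symm p, by simpa using hp, fun z w => ?_⟩
  have : (aevalAeval z w : ℂ[X][X] →ₐ[ℂ] ℂ).comp (Bivariate.equivMvPolynomial ℂ).symm.toAlgHom =
      MvPolynomial.aeval ![z, w] := by
    ext j
    fin_cases j <;> simp
  rw [← coe_aevalAeval_eq_evalEval, ← MvPolynomial.coe_aeval_eq_eval]
  exact DFunLike.congr_fun this p

lemma real_dep {S : Set (ℂ × ℂ)} (hS : S.Infinite) (p : MvPolynomial (Fin 2) ℂ) (hp : p ≠ 0)
    (hSp : ∀ v ∈ S, MvPolynomial.eval ![v.1, v.2] p = 0 ∧ ‖v.1‖ ^ 2 + ‖v.2‖ ^ 2 = 1) :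
    ∃ (U : Ultrafilter S) (j0 : Fin 4),
      let x : Fin 4 → S → ℝ := ![fun s => s.1.1.re, fun s => s.1.1.im, fun s => s.1.2.re, fun s => s.1.2.im]
      (∀ c, ¬ ∀ᶠ s in (U : Filter S), x j0 s = c) ∧
      ∀ j, ∃ Q : ℝ[X][X], Q ≠ 0 ∧ ∀ᶠ s in (U : Filter S), Q.evalEval (x j0 s) (x j s) = 0 := by
  have : Infinite S := hS.to_subtype
  let U : Ultrafilter S := hyperfilter S
  let z : S → ℂ := fun s => s.1.1
  let w : S → ℂ := fun s => s.1.2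
  let x : Fin 4 → S → ℝ := ![fun s => s.1.1.re, fun s => s.1.1.im, fun s => s.1.2.re, fun s => s.1.2.im]
  obtain ⟨P, hP0, hP⟩ := biv_of_mv p hp
  have hxm : ∀ j, x j ∈ coordSet z w := by
    intro j
    fin_cases j <;> simp [x, coordSet, z, w]
  have hxm' : ∀ j, x j ∈ coordSet w z := by
    intro j
    fin_cases j <;> simp [x, coordSet, z, w]
  have hnc : (∀ c, ¬ ∀ᶠ s in (U : Filter S), z s = c) ∨ (∀ c, ¬ ∀ᶠ s in (U : Filter S), w s = c) := by
    by_contra! h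
    obtain ⟨⟨a, ha⟩, ⟨b, hb⟩⟩ := h
    have h1 : {s : S | s.1 = (a, b)} ∈ U := by
      filter_upwards [ha, hb] with s h1 h2
      exact Prod.ext h1 h2
    refine Set.Finite.notMem_hyperfilter ?_ h1
    refine Set.Subsingleton.finite fun s hs t ht => Subtype.ext ?_
    rw [Set.mem_ofPred] at hs ht
    rw [hs, ht]
  have main : ∀ j0, (∀ c, ¬ ∀ᶠ s in (U : Filter S), x j0 s = c) → 
      ∀ j, ∃ Q : ℝ[X][X], Q ≠ 0 ∧ ∀ᶠ s in (U : Filter S), Q.evalEval (x j0 s) (x j s) = 0 := by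
    intro j0 hj0 j
    rcases hnc with h | h
    · exact complex_dep U z w P hP0 (fun s => by rw [hP]; exact (hSp s.1 s.2).1)
        (fun s => (hSp s.1 s.2).2) h _ _ (hxm j0) (hxm j) hj0
    · refine complex_dep U w z (Bivariate.swap P) (by simpa using hP0) (fun s => ?_)
        (fun s => by rw [add_comm]; exact (hSp s.1 s.2).2) h _ _ (hxm' j0) (hxm' j) hj0
      rw [← coe_aevalAeval_eq_evalEval, Bivariate.aevalAeval_swap, coe_aevalAeval_eq_evalEval, hP]
      exact (hSp s.1 s.2).1
  have hex : ∃ j0, (∀ c, ¬ ∀ᶠ s in (U : Filter S), x j0 s = c) := by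
    rcases hnc with h | h
    · rcases complex_nonconst U z h with h | h
      · exact ⟨0, h⟩
      · exact ⟨1, h⟩
    · rcases complex_nonconst U w h with h | h
      · exact ⟨2, h⟩
      · exact ⟨3, h⟩
  obtain ⟨j0, hj0⟩ := hex
  exact ⟨U, j0, hj0, main j0 hj0⟩

/-- Reparametrize a curve defined near a point to `(0,1)`. -/
lemma reparam (S : Set (ℂ × ℂ)) (δ : ℝ → ℂ × ℂ) (t0 : ℝ) (hδ : AnalyticAt ℝ δ t0)
    (hS : ∀ᶠ t in 𝓝 t0, δ t ∈ S) (u : ℂ × ℂ → ℝ) (hu : ∀ᶠ t in 𝓝 t0, u (δ t) = t) :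
    ∃ γ : ℝ → ℂ × ℂ,
      (∀ t ∈ Set.Ioo (0:ℝ) 1, AnalyticAt ℝ γ t) ∧ (∀ t ∈ Set.Ioo (0:ℝ) 1, γ t ∈ S) ∧
      ∃ t₁ ∈ Set.Ioo (0:ℝ) 1, ∃ t₂ ∈ Set.Ioo (0:ℝ) 1, γ t₁ ≠ γ t₂ := by
  have hall := hδ.eventually_analyticAt.and (hS.and hu)
  obtain ⟨ε, hε, hb⟩ := Metric.eventually_nhds_iff.1 hall
  have hin : ∀ t ∈ Set.Ioo (0:ℝ) 1, dist (t0 + ε * t) t0 < ε := by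
    intro t ht
    rw [Real.dist_eq, add_sub_cancel_left, abs_of_pos (mul_pos hε ht.1)]
    nlinarith [ht.2]
  refine ⟨fun t => δ (t0 + ε * t), fun t ht => ?_, fun t ht => (hb (hin t ht)).2.1,
    1 / 4, by norm_num, 1 / 2, by norm_num, fun h => ?_⟩
  · exact (hb (hin t ht)).1.comp (f := fun t => t0 + ε * t) (by fun_prop)
  · have h1 := (hb (hin (1 / 4) (by norm_num))).2.2
    have h2 := (hb (hin (1 / 2) (by norm_num))).2.2
    simp only at h
    rw [h, h2] at h1
    linarith

lemma main_aux (p : MvPolynomial (Fin 2) ℂ) (hp : p ≠ 0) (S : Set (ℂ × ℂ)) (hSi : S.Infinite)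
    (hSp : S = {v : ℂ × ℂ | MvPolynomial.eval ![v.1, v.2] p = 0 ∧ ‖v.1‖ ^ 2 + ‖v.2‖ ^ 2 = 1}) :
    ∃ γ : ℝ → ℂ × ℂ,
      (∀ t ∈ Set.Ioo (0:ℝ) 1, AnalyticAt ℝ γ t) ∧ (∀ t ∈ Set.Ioo (0:ℝ) 1, γ t ∈ S) ∧
      ∃ t₁ ∈ Set.Ioo (0:ℝ) 1, ∃ t₂ ∈ Set.Ioo (0:ℝ) 1, γ t₁ ≠ γ t₂ := by
  have hSm : ∀ v, v ∈ S ↔ MvPolynomial.eval ![v.1, v.2] p = 0 ∧ ‖v.1‖ ^ 2 + ‖v.2‖ ^ 2 = 1 := by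
    intro v; rw [hSp]; rfl
  obtain ⟨U, j0, hnc, hQ⟩ := real_dep hSi p hp fun v hv => (hSm v).1 hv
  obtain ⟨c, t0, hc, hev⟩ := real_curve U _ j0 hnc hQ
  obtain ⟨a, b, hab⟩ := split_mv p
  have hcC : ∀ j, AnalyticAt ℝ (fun t => (c j t : ℂ)) t0 := fun j =>
    (Complex.ofRealCLM.analyticAt _).comp (hc j)
  have hnorm : ∀ r s : ℝ, ‖(r : ℂ) + s * Complex.I‖ ^ 2 = r ^ 2 + s ^ 2 := by
    intro r s
    rw [← Complex.normSq_eq_norm_sq, Complex.normSq_add_mul_I]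
  have hpt : ∀ s : S, MvPolynomial.eval (fun j => (![fun s => s.1.1.re, fun s => s.1.1.im,
        fun s => s.1.2.re, fun s => s.1.2.im] : Fin 4 → S → ℝ) j s) a = 0 ∧
      MvPolynomial.eval (fun j => (![fun s => s.1.1.re, fun s => s.1.1.im,
        fun s => s.1.2.re, fun s => s.1.2.im] : Fin 4 → S → ℝ) j s) b = 0 := by
    intro s
    have h1 := hab (fun j => (![fun s => s.1.1.re, fun s => s.1.1.im,
        fun s => s.1.2.re, fun s => s.1.2.im] : Fin 4 → S → ℝ) j s)
    have h2 := ((hSm s.1).1 s.2).1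
    have h3 : (![(s.1.1.re : ℂ) + s.1.1.im * Complex.I, (s.1.2.re : ℂ) + s.1.2.im * Complex.I]
      : Fin 2 → ℂ) = ![s.1.1, s.1.2] := by
      rw [Complex.re_add_im, Complex.re_add_im]
    have h4 := h1.symm.trans ((congrArg (fun v => MvPolynomial.eval v p) h3).trans h2)
    have h5 := congrArg Complex.re h4
    have h6 := congrArg Complex.im h4
    simp only [Complex.add_re, Complex.add_im, Complex.re_ofReal_mul, Complex.im_ofReal_mul,
      Complex.ofReal_re, Complex.ofReal_im, Complex.I_re, Complex.I_im, mul_zero, mul_one, add_zero,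
      zero_add, Complex.zero_re, Complex.zero_im] at h5 h6
    exact ⟨h5, h6⟩
  refine reparam S (fun t => ((c 0 t : ℂ) + c 1 t * Complex.I, (c 2 t : ℂ) + c 3 t * Complex.I)) t0
    ?_ ?_ (fun v => (![v.1.re, v.1.im, v.2.re, v.2.im] : Fin 4 → ℝ) j0) ?_
  · exact ((hcC 0).add ((hcC 1).mul analyticAt_const)).prod
      ((hcC 2).add ((hcC 3).mul analyticAt_const))
  · filter_upwards [hev] with t ht
    rw [hSm]
    constructor
    · refine (hab (fun j => c j t)).trans ?_
      rw [ht.2 a fun s => (hpt s).1, ht.2 b fun s => (hpt s).2]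
      simp
    · have := ht.2 (MvPolynomial.X 0 ^ 2 + MvPolynomial.X 1 ^ 2 + MvPolynomial.X 2 ^ 2 +
        MvPolynomial.X 3 ^ 2 - 1) (fun s => by
          have h2 := ((hSm s.1).1 s.2).2
          rw [← Complex.normSq_eq_norm_sq, ← Complex.normSq_eq_norm_sq, Complex.normSq_apply,
            Complex.normSq_apply] at h2
          simp
          linarith)
      simp only [hnorm]
      simp at this
      linarith
  · filter_upwards [hev] with t ht
    refine Eq.trans ?_ ht.1
    fin_cases j0 <;> simp

lemma sphere_case :
    ∃ γ : ℝ → ℂ × ℂ,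
      (∀ t ∈ Set.Ioo (0:ℝ) 1, AnalyticAt ℝ γ t) ∧
      (∀ t ∈ Set.Ioo (0:ℝ) 1, ‖(γ t).1‖ ^ 2 + ‖(γ t).2‖ ^ 2 = 1) ∧
      ∃ t₁ ∈ Set.Ioo (0:ℝ) 1, ∃ t₂ ∈ Set.Ioo (0:ℝ) 1, γ t₁ ≠ γ t₂ := by
  refine ⟨fun t => ((Real.cos t : ℂ), (Real.sin t : ℂ)), fun t _ => ?_, fun t _ => ?_,
    1 / 4, by norm_num, 1 / 2, by norm_num, fun h => ?_⟩
  · exact AnalyticAt.prod ((Complex.ofRealCLM.analyticAt _).comp Real.analyticAt_cos)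
      ((Complex.ofRealCLM.analyticAt _).comp Real.analyticAt_sin)
  · simp only [Complex.norm_real, Real.norm_eq_abs, sq_abs]
    exact Real.cos_sq_add_sin_sq t
  · have h1 : Real.cos (1 / 4) = Real.cos (1 / 2) :=
      Complex.ofReal_injective (congrArg Prod.fst h)
    have h2 := Real.cos_lt_cos_of_nonneg_of_le_pi_div_two (x := 1 / 4) (y := 1 / 2) (by norm_num)
      (by linarith [Real.pi_gt_three]) (by norm_num)
    linarith
end PartE

open MvPolynomial Set

/-- The zero set on the unit sphere of `ℂ²` of a polynomial `p ∈ ℂ[z,w]` is either finite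
or contains the image of a non-constant analytic curve `γ : (0,1) → Z(p) ∩ 𝕊₂`. -/
theorem stmt_9 (p : MvPolynomial (Fin 2) ℂ) :
    ({v : ℂ × ℂ | eval ![v.1, v.2] p = 0 ∧ ‖v.1‖ ^ 2 + ‖v.2‖ ^ 2 = 1}).Finite ∨
    ∃ γ : ℝ → ℂ × ℂ,
      (∀ t ∈ Ioo (0:ℝ) 1, AnalyticAt ℝ γ t) ∧
      (∀ t ∈ Ioo (0:ℝ) 1,
        γ t ∈ {v : ℂ × ℂ | eval ![v.1, v.2] p = 0 ∧ ‖v.1‖ ^ 2 + ‖v.2‖ ^ 2 = 1}) ∧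
      ∃ t₁ ∈ Ioo (0:ℝ) 1, ∃ t₂ ∈ Ioo (0:ℝ) 1, γ t₁ ≠ γ t₂ := by
  by_cases hp : p = 0
  · right
    obtain ⟨γ, h1, h2, h3⟩ := sphere_case
    exact ⟨γ, h1, fun t ht => ⟨by rw [hp, map_zero], h2 t ht⟩, h3⟩
  · by_cases hfin : ({v : ℂ × ℂ | eval ![v.1, v.2] p = 0 ∧ ‖v.1‖ ^ 2 + ‖v.2‖ ^ 2 = 1}).Finite
    · exact Or.inl hfin
    · exact Or.inr (main_aux p hp _ hfin rfl)
end

section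
/- Let p ∈ ℂ[z,w] be a polynomial, viewed as a polynomial map ℂ² → ℂ. Suppose p vanishes at finitely many points (ζ₁,η₁),…,(ζₙ,ηₙ) of the unit sphere 𝕊₂. Then there exist a constant c > 0 and a natural number q such that |p(ζ,η)| ≥ c · ∏_{i=1}^n |1 − ζζ̄ᵢ − ηη̄ᵢ|^q for all (ζ,η) ∈ 𝕊₂. -/
open MvPolynomial

namespace Loja

section abstractPart

variable {H : Type} [Field H] [LinearOrder H] [IsStrictOrderedRing H]

/-- Infinitesimal relative to all powers of `δ`. -/
def InM (δ y : H) : Prop := ∀ k : ℕ, |y| ≤ δ ^ k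

/-- The convex ring of elements bounded by some negative power of `δ`. -/
def bddRing (δ : H) (h0 : 0 < δ) (h1 : δ + δ ≤ 1) : Subring H where
  carrier := {y | ∃ k : ℕ, |y| * δ ^ k ≤ 1}
  mul_mem' := by
    rintro a b ⟨k, hk⟩ ⟨l, hl⟩
    refine ⟨k + l, ?_⟩
    rw [abs_mul, pow_add]
    calc |a| * |b| * (δ ^ k * δ ^ l) = (|a| * δ ^ k) * (|b| * δ ^ l) := by ring
      _ ≤ 1 * 1 := by
        apply mul_le_mul hk hl (by positivity) zero_le_one
      _ = 1 := one_mul 1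
  one_mem' := ⟨0, by simp⟩
  add_mem' := by
    rintro a b ⟨k, hk⟩ ⟨l, hl⟩
    refine ⟨k + l + 1, ?_⟩
    have hd : δ ≤ 1 := by linarith
    have hkk : δ ^ k ≤ 1 := pow_le_one₀ h0.le hd
    have hll : δ ^ l ≤ 1 := pow_le_one₀ h0.le hd
    have e1 : |a| * δ ^ k * (δ ^ l * δ) ≤ 1 * (1 * δ) := by gcongr
    have e2 : |b| * δ ^ l * (δ ^ k * δ) ≤ 1 * (1 * δ) := by gcongr
    calc |a + b| * δ ^ (k + l + 1) ≤ (|a| + |b|) * δ ^ (k + l + 1) := by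
          gcongr; exact abs_add_le a b
      _ = |a| * δ ^ k * (δ ^ l * δ) + |b| * δ ^ l * (δ ^ k * δ) := by ring
      _ ≤ 1 := by linarith
  zero_mem' := ⟨0, by simp⟩
  neg_mem' := by
    rintro a ⟨k, hk⟩
    exact ⟨k, by simpa using hk⟩

variable {δ : H} {h0 : 0 < δ} {h1 : δ + δ ≤ 1}

theorem mem_bdd {y : H} : y ∈ bddRing δ h0 h1 ↔ ∃ k : ℕ, |y| * δ ^ k ≤ 1 := Iff.rfl

theorem InM.mem {y : H} (hy : InM δ y) : y ∈ bddRing δ h0 h1 :=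
  ⟨0, by simpa using hy 0⟩

theorem InM.add (h0 : 0 < δ) (h1 : δ + δ ≤ 1) {y z : H} (hy : InM δ y) (hz : InM δ z) :
    InM δ (y + z) := by
  intro k
  have a := hy (k + 1)
  have b := hz (k + 1)
  have c := abs_add_le y z
  have d : (δ + δ) * δ ^ k ≤ 1 * δ ^ k := by gcongr
  rw [pow_succ] at a b
  linarith

theorem InM.neg {y : H} (hy : InM δ y) : InM δ (-y) := by
  intro k; simpa using hy k

theorem InM.zero (h0 : 0 < δ) : InM δ (0 : H) := by
  intro k; simpa using (pow_pos h0 k).le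

theorem InM.mul {a y : H} (ha : a ∈ bddRing δ h0 h1) (hy : InM δ y) : InM δ (a * y) := by
  obtain ⟨l, hl⟩ := ha
  intro k
  rw [abs_mul]
  calc |a| * |y| ≤ |a| * δ ^ (l + k) := by gcongr; exact hy _
    _ = (|a| * δ ^ l) * δ ^ k := by ring
    _ ≤ 1 * δ ^ k := by gcongr
    _ = δ ^ k := one_mul _

theorem InM.of_abs_le {y z : H} (hy : InM δ y) (h : |z| ≤ |y|) : InM δ z :=
  fun k => h.trans (hy k)

theorem not_InM_one (h0 : 0 < δ) (h1 : δ + δ ≤ 1) : ¬ InM δ (1 : H) := by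
  intro h
  have := h 1
  simp at this
  linarith

theorem inv_mem {a : H} (ha : ¬ InM δ a) : a⁻¹ ∈ bddRing δ h0 h1 := by
  unfold InM at ha
  push Not at ha
  obtain ⟨k, hk⟩ := ha
  refine ⟨k, ?_⟩
  have : 0 < |a| := (pow_pos h0 k).trans hk
  rw [abs_inv, inv_mul_le_iff₀ this]
  linarith

/-- Intermediate value property for polynomials. -/
def PolyIVT (H : Type) [Field H] [LinearOrder H] : Prop :=
  ∀ (P : Polynomial H) (a b : H), P.eval a ≤ 0 → 0 ≤ P.eval b →
    ∃ c ∈ Set.uIcc a b, P.eval c = 0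

theorem hensel (hI : PolyIVT H) (Q : Polynomial (bddRing δ h0 h1)) (a : bddRing δ h0 h1)
    (hQ : InM δ ((Q.eval a : bddRing δ h0 h1) : H)) (hQ' : ¬ InM δ ((Q.derivative.eval a : bddRing δ h0 h1) : H)) :
    ∃ b : bddRing δ h0 h1, Q.eval b = 0 ∧ InM δ ((b : H) - a) := by
  set e : bddRing δ h0 h1 := Q.eval a with he
  set u : bddRing δ h0 h1 := Q.derivative.eval a with hu
  have hu0 : (u : H) ≠ 0 := by
    intro h; exact hQ' (h ▸ InM.zero h0)
  let v : bddRing δ h0 h1 := ⟨(u : H)⁻¹, inv_mem hQ'⟩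
  have huv : u * v = 1 := by
    apply Subtype.ext
    simp [v, hu0]
  let h : bddRing δ h0 h1 := -2 * v * e
  have hh : InM δ (h : H) := by
    have : (h : H) = ((-2 * v : bddRing δ h0 h1) : H) * (e : H) := by simp [h]
    rw [this]
    exact InM.mul (-2 * v : bddRing δ h0 h1).2 hQ
  obtain ⟨G, hG⟩ := Q.binomExpansion a h
  rw [← he, ← hu] at hG
  let w : bddRing δ h0 h1 := 4 * G * v ^ 2
  have hw : InM δ ((w * e : bddRing δ h0 h1) : H) := by
    rw [Subring.coe_mul]; exact InM.mul w.2 hQ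
  have hval : Q.eval (a + h) = -e * (1 - w * e) := by
    rw [hG]
    have : u * h = -2 * e := by
      calc u * h = -2 * (u * v) * e := by simp only [h]; ring
        _ = _ := by rw [huv]; ring
    rw [this]
    simp only [h, w]; ring
  have hpos : (0:H) < 1 - ((w * e : bddRing δ h0 h1) : H) := by
    have := (abs_le.1 (hw 1)).2
    rw [pow_one] at this
    linarith
  have hvalH : ((Q.eval (a + h) : bddRing δ h0 h1) : H)
      = -(e : H) * (1 - ((w * e : bddRing δ h0 h1) : H)) := by
    rw [hval]; simp
  let P : Polynomial H := Q.map (bddRing δ h0 h1).subtype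
  have hP : ∀ x : bddRing δ h0 h1, P.eval (x : H) = ((Q.eval x : bddRing δ h0 h1) : H) := by
    intro x
    exact Polynomial.eval_map_apply (f := (bddRing δ h0 h1).subtype) (p := Q) x
  have key : ∃ c ∈ Set.uIcc (a : H) ((a + h : bddRing δ h0 h1) : H), P.eval c = 0 := by
    rcases le_total (e : H) 0 with hle | hle
    · apply hI
      · rw [hP]; exact hle
      · rw [hP, hvalH]; exact mul_nonneg (neg_nonneg.2 hle) hpos.le
    · rw [Set.uIcc_comm]
      apply hI
      · rw [hP, hvalH]; exact mul_nonpos_of_nonpos_of_nonneg (neg_nonpos.2 hle) hpos.le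
      · rw [hP]; exact hle
  obtain ⟨c, hc, hc0⟩ := key
  have hca : InM δ (c - a) := by
    apply hh.of_abs_le
    have := Set.abs_sub_left_of_mem_uIcc hc
    simpa using this
  have hcO : c ∈ bddRing δ h0 h1 := by
    have : c = (c - a) + a := by ring
    rw [this]; exact add_mem hca.mem a.2
  refine ⟨⟨c, hcO⟩, ?_, hca⟩
  apply Subtype.ext
  rw [← hP]; exact hc0

theorem aeval_mem {E : Subfield H} (hE : ∀ x ∈ E, x ∈ bddRing δ h0 h1) {b : H}
    (hb : b ∈ bddRing δ h0 h1) (s : Polynomial E) : Polynomial.aeval b s ∈ bddRing δ h0 h1 := by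
  rw [Polynomial.aeval_eq_sum_range]
  refine sum_mem fun i _ => ?_
  rw [Subfield.smul_def]
  exact mul_mem (hE _ (s.coeff i).2) (pow_mem hb i)

theorem eq_zero_of_InM {E : Subfield H} (hE : ∀ x ∈ E, x ∈ bddRing δ h0 h1) {x : H}
    (hx : x ∈ E) (hm : InM δ x) : x = 0 := by
  by_contra hne
  have := InM.mul (hE _ (E.inv_mem hx)) hm
  rw [inv_mul_cancel₀ hne] at this
  exact not_InM_one h0 h1 this

theorem coeff_field (hI : PolyIVT H) (E0 : Subfield H) (hE0 : ∀ x ∈ E0, x ∈ bddRing δ h0 h1) :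
    ∃ E : Subfield H, E0 ≤ E ∧ (∀ x ∈ E, x ∈ bddRing δ h0 h1) ∧
      ∀ a ∈ bddRing δ h0 h1, ∃ b ∈ E, InM δ (b - a) := by
  obtain ⟨E, hE0E, hmax⟩ := zorn_le_nonempty₀ {E : Subfield H | ∀ x ∈ E, x ∈ bddRing δ h0 h1}
    (by
      intro c hc hchain y hy
      refine ⟨sSup c, ?_, fun z hz => le_sSup hz⟩
      intro x hx
      obtain ⟨s, hs, hxs⟩ := (Subfield.mem_sSup_of_directedOn ⟨y, hy⟩ hchain.directedOn).1 hx
      exact hc hs x hxs) E0 hE0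
  have hE : ∀ x ∈ E, x ∈ bddRing δ h0 h1 := hmax.1
  refine ⟨E, hE0E, hE, ?_⟩
  -- adjoining
  have adj : ∀ b ∈ bddRing δ h0 h1,
      (∀ s : Polynomial E, InM δ (Polynomial.aeval b s) → Polynomial.aeval b s = 0) → b ∈ E := by
    intro b hb hs
    let L := (IntermediateField.adjoin E {b}).toSubfield
    have hEL : E ≤ L := by
      intro x hx
      exact (IntermediateField.adjoin E {b}).algebraMap_mem ⟨x, hx⟩
    have hbL : b ∈ L := IntermediateField.mem_adjoin_simple_self E b
    have hL : ∀ x ∈ L, x ∈ bddRing δ h0 h1 := by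
      intro x hx
      obtain ⟨r, s, rfl⟩ := (IntermediateField.mem_adjoin_simple_iff E x).1 hx
      by_cases hm : InM δ (Polynomial.aeval b s)
      · rw [hs s hm, div_zero]; exact zero_mem _
      · rw [div_eq_mul_inv]
        exact mul_mem (aeval_mem hE hb r) (inv_mem hm)
    exact hmax.2 hL hEL hbL
  intro a ha
  by_cases htr : ∀ s : Polynomial E, InM δ (Polynomial.aeval a s) → s = 0
  · refine ⟨a, adj a ha fun s hs => by rw [htr s hs, map_zero], ?_⟩
    rw [sub_self]; exact InM.zero h0
  push Not at htr
  obtain ⟨s, hs, hs0⟩ := htr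
  have irr : ∀ s : Polynomial E, s ≠ 0 → InM δ (Polynomial.aeval a s) →
      ∃ Q : Polynomial E, Irreducible Q ∧ InM δ (Polynomial.aeval a Q) := by
    intro s
    induction s using WfDvdMonoid.induction_on_irreducible with
    | zero => intro h; exact absurd rfl h
    | unit u hu =>
      intro _ hm
      exfalso
      obtain ⟨r, hr, rfl⟩ := Polynomial.isUnit_iff.1 hu
      rw [Polynomial.aeval_C] at hm
      have := eq_zero_of_InM hE r.2 hm
      exact hr.ne_zero (Subtype.ext this)
    | mul t i ht hi ih =>
      intro _ hm
      by_cases him : InM δ (Polynomial.aeval a i)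
      · exact ⟨i, hi, him⟩
      · apply ih ht
        rw [map_mul] at hm
        have hne : Polynomial.aeval a i ≠ 0 := fun h => him (h ▸ InM.zero h0)
        have := InM.mul (inv_mem (h0 := h0) (h1 := h1) him) hm
        rwa [inv_mul_cancel_left₀ hne] at this
  obtain ⟨Q, hQ, hQm⟩ := irr s hs0 hs
  have hsep := hQ.separable
  let ι : E →+* bddRing δ h0 h1 := E.subtype.codRestrict _ (fun x => hE x x.2)
  have hev : ∀ (t : Polynomial E) (x : bddRing δ h0 h1),
      (((t.map ι).eval x : bddRing δ h0 h1) : H) = Polynomial.aeval (x : H) t := by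
    intro t x
    rw [Polynomial.eval_map, Polynomial.aeval_def]
    have := Polynomial.hom_eval₂ t ι (bddRing δ h0 h1).subtype x
    exact this
  have hQ' : ¬ InM δ (Polynomial.aeval a (Polynomial.derivative Q)) := by
    intro hm
    obtain ⟨u, v, huv⟩ := hsep
    have h3 := congrArg (Polynomial.aeval a) huv
    rw [map_add, map_mul, map_mul, map_one] at h3
    have := InM.add h0 h1 (InM.mul (aeval_mem hE ha u) hQm) (InM.mul (aeval_mem hE ha v) hm)
    rw [h3] at this
    exact not_InM_one h0 h1 this
  obtain ⟨b, hb0, hba⟩ := hensel hI (Q.map ι) ⟨a, ha⟩ (by rw [hev]; exact hQm)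
    (by rw [Polynomial.derivative_map, hev]; exact hQ')
  have hQb : Polynomial.aeval (b : H) Q = 0 := by rw [← hev, hb0]; rfl
  refine ⟨b, adj b b.2 ?_, hba⟩
  intro t ht
  by_cases hd : Q ∣ t
  · obtain ⟨r, rfl⟩ := hd
    rw [map_mul, hQb, zero_mul]
  · exfalso
    obtain ⟨u, v, huv⟩ := (hQ.coprime_iff_not_dvd).2 hd
    have h3 := congrArg (Polynomial.aeval (b : H)) huv
    rw [map_add, map_mul, map_mul, map_one, hQb, mul_zero, zero_add] at h3
    have := InM.mul (aeval_mem hE b.2 v) ht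
    rw [h3] at this
    exact not_InM_one h0 h1 this

theorem mv_congr {σ : Type} (E : Subfield H) (hE : ∀ x ∈ E, x ∈ bddRing δ h0 h1)
    (φ : ℝ →+* H) (hφ : ∀ r, φ r ∈ E) (x b : σ → H) (hb : ∀ i, b i ∈ E)
    (hx : ∀ i, x i ∈ bddRing δ h0 h1) (hbx : ∀ i, InM δ (b i - x i)) (f : MvPolynomial σ ℝ) :
    eval₂ φ b f ∈ E ∧ eval₂ φ x f ∈ bddRing δ h0 h1 ∧ InM δ (eval₂ φ b f - eval₂ φ x f) := by
  induction f using MvPolynomial.induction_on with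
  | C a => simp only [eval₂_C, sub_self]; exact ⟨hφ a, hE _ (hφ a), InM.zero h0⟩
  | add p q hp hq =>
    simp only [eval₂_add]
    refine ⟨add_mem hp.1 hq.1, add_mem hp.2.1 hq.2.1, ?_⟩
    have := InM.add h0 h1 hp.2.2 hq.2.2
    convert this using 1; ring
  | mul_X p i hp =>
    simp only [eval₂_mul, eval₂_X]
    refine ⟨mul_mem hp.1 (hb i), mul_mem hp.2.1 (hx i), ?_⟩
    have := InM.add h0 h1 (InM.mul (hE _ hp.1) (hbx i)) (InM.mul (hx i) hp.2.2)
    convert this using 1; ring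

end abstractPart

open Filter in
/-- The hyperreals, as germs along a nonprincipal ultrafilter. -/
abbrev HH := Germ (hyperfilter ℕ : Filter ℕ) ℝ

open Filter in
theorem ivt_HH : PolyIVT HH := by
  intro P a b ha hb
  let π : (ℕ → ℝ) →+* HH := Germ.coeRingHom _
  have hπ : Function.Surjective π := by
    intro x
    induction x using Germ.inductionOn with
    | _ f => exact ⟨f, rfl⟩
  obtain ⟨Q, rfl⟩ := Polynomial.map_surjective π hπ P
  obtain ⟨α, rfl⟩ := hπ a
  obtain ⟨β, rfl⟩ := hπ b
  rw [Polynomial.eval_map_apply] at ha hb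
  let q : ℕ → Polynomial ℝ := fun k => Q.map (Pi.evalRingHom (fun _ : ℕ => ℝ) k)
  have hq : ∀ (γ : ℕ → ℝ) (k : ℕ), (Q.eval γ) k = (q k).eval (γ k) := by
    intro γ k
    exact (Polynomial.eval_map_apply (f := Pi.evalRingHom (fun _ : ℕ => ℝ) k) (p := Q) γ).symm
  have ha' : ∀ᶠ k in (hyperfilter ℕ : Filter ℕ), (Q.eval α) k ≤ 0 := Germ.coe_le.1 ha
  have hb' : ∀ᶠ k in (hyperfilter ℕ : Filter ℕ), 0 ≤ (Q.eval β) k := Germ.coe_le.1 hb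
  have hex : ∀ k, ∃ c : ℝ, (Q.eval α) k ≤ 0 → 0 ≤ (Q.eval β) k →
      c ∈ Set.uIcc (α k) (β k) ∧ (q k).eval c = 0 := by
    intro k
    by_cases h : (Q.eval α) k ≤ 0 ∧ 0 ≤ (Q.eval β) k
    · have := intermediate_value_uIcc (a := α k) (b := β k) (f := fun x => (q k).eval x)
        (q k).continuous.continuousOn
      have h0 : (0:ℝ) ∈ Set.uIcc ((q k).eval (α k)) ((q k).eval (β k)) := by
        rw [← hq, ← hq]; exact Set.mem_uIcc.2 (Or.inl h)
      obtain ⟨c, hc, hc0⟩ := this h0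
      exact ⟨c, fun _ _ => ⟨hc, hc0⟩⟩
    · exact ⟨0, fun h1 h2 => absurd ⟨h1, h2⟩ h⟩
  choose γ hγ using hex
  refine ⟨π γ, ?_, ?_⟩
  · have hb1 : ∀ᶠ k in (hyperfilter ℕ : Filter ℕ),
        (α k ≤ γ k ∧ γ k ≤ β k) ∨ (β k ≤ γ k ∧ γ k ≤ α k) := by
      filter_upwards [ha', hb'] with k h1 h2
      exact Set.mem_uIcc.1 (hγ k h1 h2).1
    rw [Set.mem_uIcc]
    rcases Ultrafilter.eventually_or.1 hb1 with h | h
    · left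
      exact ⟨Germ.coe_le.2 (h.mono fun k hk => hk.1), Germ.coe_le.2 (h.mono fun k hk => hk.2)⟩
    · right
      exact ⟨Germ.coe_le.2 (h.mono fun k hk => hk.1), Germ.coe_le.2 (h.mono fun k hk => hk.2)⟩
  · rw [Polynomial.eval_map_apply]
    apply Germ.coe_eq.2
    filter_upwards [ha', hb'] with k h1 h2
    rw [hq]; exact (hγ k h1 h2).2

open Filter in
theorem abs_coe (f : ℕ → ℝ) : |(f : HH)| = ((fun k => |f k| : ℕ → ℝ) : HH) := by
  rw [Germ.abs_def]; rfl

open Filter in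
theorem eval_germ {d : ℕ} (f : MvPolynomial (Fin d) ℝ) (Y : Fin d → (ℕ → ℝ)) :
    eval₂ ((Germ.coeRingHom (hyperfilter ℕ : Filter ℕ)).comp (Pi.constRingHom ℕ ℝ) : ℝ →+* HH)
      (fun i => ((Y i : ℕ → ℝ) : HH)) f = ((fun k => eval (fun i => Y i k) f : ℕ → ℝ) : HH) := by
  induction f using MvPolynomial.induction_on with
  | C a => simp only [eval₂_C, eval_C]; rfl
  | add p q hp hq => simp only [eval₂_add, eval_add, hp, hq]; rfl
  | mul_X p i hp => simp only [eval₂_mul, eval_mul, eval₂_X, eval_X, hp]; rfl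

open Filter in
/-- Łojasiewicz inequality at an isolated zero of a real polynomial. -/
theorem lojasiewicz {d : ℕ} (f : MvPolynomial (Fin d) ℝ) (x0 : Fin d → ℝ) (ε : ℝ) (hε : 0 < ε)
    (hiso : ∀ x, ‖x - x0‖ < ε → eval x f = 0 → x = x0) :
    ∃ N : ℕ, ∃ r > (0:ℝ), ∀ x, ‖x - x0‖ < r → ‖x - x0‖ ^ N ≤ |eval x f| := by
  by_contra hcon
  push Not at hcon
  have hex : ∀ k : ℕ, ∃ x : Fin d → ℝ, ‖x - x0‖ < 1 / ((k:ℝ) + 1) ∧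
      |eval x f| < ‖x - x0‖ ^ (k + 1) := fun k => hcon (k + 1) _ (by positivity)
  choose X hX1 hX2 using hex
  let D : ℕ → ℝ := fun k => ‖X k - x0‖
  have hDpos : ∀ k, 0 < D k := by
    intro k
    rcases (norm_nonneg (X k - x0)).eq_or_lt with h | h
    · have := hX2 k
      rw [← h] at this
      simp at this
      exact absurd this (not_lt.2 (abs_nonneg _))
    · exact h
  have hDlim : Tendsto D atTop (nhds 0) :=
    squeeze_zero (fun k => (hDpos k).le) (fun k => (hX1 k).le) tendsto_one_div_add_atTop_nhds_zero_nat
  have hsmall : ∀ t : ℝ, 0 < t → ∀ᶠ k in (hyperfilter ℕ : Filter ℕ), D k < t := by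
    intro t ht
    have := hDlim.eventually (gt_mem_nhds ht)
    exact Nat.hyperfilter_le_atTop this
  let δ : HH := (D : HH)
  have h0 : (0 : HH) < δ := Germ.coe_lt.2 (Eventually.of_forall hDpos)
  have h1 : δ + δ ≤ 1 := by
    apply Germ.coe_le.2
    filter_upwards [hsmall (1/2) (by norm_num)] with k hk
    change D k + D k ≤ 1
    linarith
  let π : (ℕ → ℝ) →+* HH := Germ.coeRingHom _
  let φ : ℝ →+* HH := π.comp (Pi.constRingHom ℕ ℝ)
  have hbd : ∀ (g : ℕ → ℝ) (C : ℝ), (∀ᶠ k in (hyperfilter ℕ : Filter ℕ), |g k| ≤ C) →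
      (g : HH) ∈ bddRing δ h0 h1 := by
    intro g C hg
    refine ⟨1, ?_⟩
    rw [abs_coe]
    apply Germ.coe_le.2
    filter_upwards [hg, hsmall (1 / (|C| + 1)) (by positivity)] with k hk hk2
    change |g k| * (D k) ^ 1 ≤ 1
    rw [pow_one]
    have hC : |g k| ≤ |C| + 1 := by linarith [le_abs_self C]
    calc |g k| * D k ≤ (|C| + 1) * (1 / (|C| + 1)) :=
          mul_le_mul hC hk2.le (hDpos k).le (by positivity)
      _ = 1 := by field_simp
  obtain ⟨E, hE0, hE, hlift⟩ := coeff_field (δ := δ) (h0 := h0) (h1 := h1) ivt_HH φ.fieldRange (by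
    rintro _ ⟨r, rfl⟩
    exact hbd (fun _ => r) |r| (Eventually.of_forall fun _ => le_rfl))
  let x : Fin d → HH := fun i => ((fun k => X k i : ℕ → ℝ) : HH)
  have hx : ∀ i, x i ∈ bddRing δ h0 h1 := by
    intro i
    apply hbd _ (|x0 i| + 1)
    filter_upwards [hsmall 1 one_pos] with k hk
    have h2 : |X k i - x0 i| ≤ D k := norm_le_pi_norm (X k - x0) i
    have h3 := abs_sub_abs_le_abs_sub (X k i) (x0 i)
    linarith
  choose b hbE hbx using fun i => hlift (x i) (hx i)
  obtain ⟨hfE, -, hfm⟩ := mv_congr E hE φ (fun r => hE0 ⟨r, rfl⟩) x b hbE hx hbx f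
  have heval : ∀ Y : Fin d → (ℕ → ℝ), eval₂ φ (fun i => ((Y i : ℕ → ℝ) : HH)) f
      = ((fun k => eval (fun i => Y i k) f : ℕ → ℝ) : HH) := by
    exact fun Y => eval_germ f Y
  have hfx : InM δ (eval₂ φ x f) := by
    intro N
    rw [heval (fun i k => X k i), abs_coe]
    apply Germ.coe_le.2
    have hN : ∀ᶠ k in (hyperfilter ℕ : Filter ℕ), N ≤ k :=
      Nat.hyperfilter_le_atTop (eventually_ge_atTop N)
    filter_upwards [hN, hsmall 1 one_pos] with k hk hk1
    change |eval (X k) f| ≤ (D k) ^ N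
    refine (hX2 k).le.trans ?_
    exact pow_le_pow_of_le_one (hDpos k).le hk1.le (by omega)
  have hfb : eval₂ φ b f = 0 := by
    apply eq_zero_of_InM hE hfE
    have := InM.add h0 h1 hfm hfx
    simpa using this
  have hrep : ∀ i, ∃ Y : ℕ → ℝ, (Y : HH) = b i := by
    intro i
    induction b i using Germ.inductionOn with
    | _ g => exact ⟨g, rfl⟩
  choose Y hY using hrep
  have hb' : b = fun i => ((Y i : ℕ → ℝ) : HH) := funext fun i => (hY i).symm
  rw [hb', heval] at hfb
  have hz : ∀ᶠ k in (hyperfilter ℕ : Filter ℕ), eval (fun i => Y i k) f = 0 := Germ.coe_eq.1 hfb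
  have hclose : ∀ᶠ k in (hyperfilter ℕ : Filter ℕ), ∀ i, |Y i k - X k i| ≤ D k ^ 2 := by
    rw [eventually_all]
    intro i
    have := hbx i 2
    rw [← hY i] at this
    change |((fun k => Y i k - X k i : ℕ → ℝ) : HH)| ≤ _ at this
    rw [abs_coe] at this
    exact Germ.coe_le.1 this
  obtain ⟨k, hk1, hk2, hk3, hk4⟩ := (hz.and (hclose.and ((hsmall (1/2) (by norm_num)).and
    (hsmall (ε/2) (by positivity))))).exists
  set y : Fin d → ℝ := fun i => Y i k with hy
  have hyX : ‖y - X k‖ ≤ D k ^ 2 :=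
    (pi_norm_le_iff_of_nonneg (by positivity)).2 fun i => hk2 i
  have hD := hDpos k
  have hhalf : D k ^ 2 < D k := by nlinarith
  have hyx0 : ‖y - x0‖ < ε := by
    have : ‖y - x0‖ ≤ ‖y - X k‖ + D k := norm_sub_le_norm_sub_add_norm_sub y (X k) x0
    linarith
  have := hiso y hyx0 hk1
  rw [this, norm_sub_rev] at hyX
  change D k ≤ D k ^ 2 at hyX
  linarith

theorem re_im (p : MvPolynomial (Fin 2) ℂ) : ∃ R J : MvPolynomial (Fin 4) ℝ, ∀ z w : ℂ,
    (eval ![z, w] p).re = eval ![z.re, z.im, w.re, w.im] R ∧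
    (eval ![z, w] p).im = eval ![z.re, z.im, w.re, w.im] J := by
  induction p using MvPolynomial.induction_on with
  | C a => exact ⟨C a.re, C a.im, fun z w => by simp⟩
  | add p q hp hq =>
    obtain ⟨R, J, h⟩ := hp
    obtain ⟨R', J', h'⟩ := hq
    refine ⟨R + R', J + J', fun z w => ?_⟩
    simp [(h z w).1, (h z w).2, (h' z w).1, (h' z w).2]
  | mul_X p i hp =>
    obtain ⟨R, J, h⟩ := hp
    fin_cases i
    · refine ⟨R * X 0 - J * X 1, R * X 1 + J * X 0, fun z w => ?_⟩
      simp [Complex.mul_re, Complex.mul_im, (h z w).1, (h z w).2]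
    · refine ⟨R * X 2 - J * X 3, R * X 3 + J * X 2, fun z w => ?_⟩
      simp [Complex.mul_re, Complex.mul_im, (h z w).1, (h z w).2]

/-- Real coordinates. -/
def co (x : ℂ × ℂ) : Fin 4 → ℝ := ![x.1.re, x.1.im, x.2.re, x.2.im]

theorem co_surj (v : Fin 4 → ℝ) : ∃ x, co x = v :=
  ⟨(⟨v 0, v 1⟩, ⟨v 2, v 3⟩), by ext i; fin_cases i <;> rfl⟩

theorem norm_le_co (x y : ℂ × ℂ) :
    ‖x.1 - y.1‖ ≤ 2 * ‖co x - co y‖ ∧ ‖x.2 - y.2‖ ≤ 2 * ‖co x - co y‖ := by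
  have h := fun i => norm_le_pi_norm (co x - co y) i
  have a0 := h 0
  have a1 := h 1
  have a2 := h 2
  have a3 := h 3
  simp [co] at a0 a1 a2 a3
  have b1 := Complex.norm_le_abs_re_add_abs_im (x.1 - y.1)
  have b2 := Complex.norm_le_abs_re_add_abs_im (x.2 - y.2)
  simp only [Complex.sub_re, Complex.sub_im] at b1 b2
  constructor
  · refine b1.trans ?_
    change _ ≤ 2 * ‖![x.1.re, x.1.im, x.2.re, x.2.im] - ![y.1.re, y.1.im, y.2.re, y.2.im]‖
    simp
    linarith
  · refine b2.trans ?_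
    change _ ≤ 2 * ‖![x.1.re, x.1.im, x.2.re, x.2.im] - ![y.1.re, y.1.im, y.2.re, y.2.im]‖
    simp
    linarith

theorem co_le_norm (x y : ℂ × ℂ) : ‖co x - co y‖ ≤ ‖x - y‖ := by
  have h1 : ‖x.1 - y.1‖ ≤ ‖x - y‖ := norm_fst_le (x - y)
  have h2 : ‖x.2 - y.2‖ ≤ ‖x - y‖ := norm_snd_le (x - y)
  rw [pi_norm_le_iff_of_nonneg (norm_nonneg _)]
  intro i
  fin_cases i
  · exact (Complex.abs_re_le_norm (x.1 - y.1)).trans h1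
  · exact (Complex.abs_im_le_norm (x.1 - y.1)).trans h1
  · exact (Complex.abs_re_le_norm (x.2 - y.2)).trans h2
  · exact (Complex.abs_im_le_norm (x.2 - y.2)).trans h2

/-- The factor attached to the point `y`. -/
noncomputable def fac (x y : ℂ × ℂ) : ℝ :=
  ‖1 - x.1 * (starRingEnd ℂ) y.1 - x.2 * (starRingEnd ℂ) y.2‖

theorem fac_le (x y : ℂ × ℂ) (hy : ‖y.1‖ ^ 2 + ‖y.2‖ ^ 2 = 1) :
    fac x y ≤ ‖x.1 - y.1‖ + ‖x.2 - y.2‖ := by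
  have h : (1 : ℂ) = y.1 * (starRingEnd ℂ) y.1 + y.2 * (starRingEnd ℂ) y.2 := by
    rw [Complex.mul_conj', Complex.mul_conj']
    exact_mod_cast hy.symm
  have e : 1 - x.1 * (starRingEnd ℂ) y.1 - x.2 * (starRingEnd ℂ) y.2
      = -((x.1 - y.1) * (starRingEnd ℂ) y.1 + (x.2 - y.2) * (starRingEnd ℂ) y.2) := by
    rw [h]; ring
  have n1 : ‖y.1‖ ≤ 1 := by nlinarith [norm_nonneg y.1, sq_nonneg ‖y.2‖]
  have n2 : ‖y.2‖ ≤ 1 := by nlinarith [norm_nonneg y.2, sq_nonneg ‖y.1‖]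
  unfold fac
  rw [e, norm_neg]
  refine (norm_add_le _ _).trans ?_
  rw [norm_mul, norm_mul, RCLike.norm_conj, RCLike.norm_conj]
  have := mul_le_mul_of_nonneg_left n1 (norm_nonneg (x.1 - y.1))
  have := mul_le_mul_of_nonneg_left n2 (norm_nonneg (x.2 - y.2))
  linarith

theorem fac_le_four (x y : ℂ × ℂ) (hx : ‖x.1‖ ^ 2 + ‖x.2‖ ^ 2 = 1)
    (hy : ‖y.1‖ ^ 2 + ‖y.2‖ ^ 2 = 1) : fac x y ≤ 4 := by
  have := fac_le x y hy
  have n1 : ‖y.1‖ ≤ 1 := by nlinarith [norm_nonneg y.1, sq_nonneg ‖y.2‖]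
  have n2 : ‖y.2‖ ≤ 1 := by nlinarith [norm_nonneg y.2, sq_nonneg ‖y.1‖]
  have n3 : ‖x.1‖ ≤ 1 := by nlinarith [norm_nonneg x.1, sq_nonneg ‖x.2‖]
  have n4 : ‖x.2‖ ≤ 1 := by nlinarith [norm_nonneg x.2, sq_nonneg ‖x.1‖]
  have := norm_sub_le x.1 y.1
  have := norm_sub_le x.2 y.2
  linarith

/-- The unit sphere. -/
def Sph : Set (ℂ × ℂ) := {x | ‖x.1‖ ^ 2 + ‖x.2‖ ^ 2 = 1}

theorem compact_Sph : IsCompact Sph := by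
  apply Metric.isCompact_of_isClosed_isBounded
  · exact isClosed_eq (by fun_prop) continuous_const
  · refine (Metric.isBounded_closedBall (x := (0 : ℂ × ℂ)) (r := 1)).subset ?_
    intro x hx
    have hx : ‖x.1‖ ^ 2 + ‖x.2‖ ^ 2 = 1 := hx
    rw [mem_closedBall_zero_iff, Prod.norm_def]
    apply max_le
    · nlinarith [norm_nonneg x.1, sq_nonneg ‖x.2‖]
    · nlinarith [norm_nonneg x.2, sq_nonneg ‖x.1‖]

theorem local_bound (p : MvPolynomial (Fin 2) ℂ) (n : ℕ) (pts : Fin n → ℂ × ℂ)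
    (hzero : ∀ ζ η : ℂ, ‖ζ‖ ^ 2 + ‖η‖ ^ 2 = 1 →
      (eval ![ζ, η] p = 0 ↔ ∃ i, (ζ, η) = pts i)) (i : Fin n) :
    ∃ N : ℕ, ∃ r > (0:ℝ), ∀ x ∈ Sph, ‖co x - co (pts i)‖ < r →
      ‖co x - co (pts i)‖ ^ N ≤ ‖eval ![x.1, x.2] p‖ ^ 2 := by
  obtain ⟨R, J, hRJ⟩ := re_im p
  let f : MvPolynomial (Fin 4) ℝ :=
    R ^ 2 + J ^ 2 + (X 0 ^ 2 + X 1 ^ 2 + X 2 ^ 2 + X 3 ^ 2 - 1) ^ 2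
  have hf : ∀ x : ℂ × ℂ, eval (co x) f =
      ‖eval ![x.1, x.2] p‖ ^ 2 + (‖x.1‖ ^ 2 + ‖x.2‖ ^ 2 - 1) ^ 2 := by
    intro x
    obtain ⟨h1, h2⟩ := hRJ x.1 x.2
    rw [Complex.sq_norm, Complex.sq_norm, Complex.sq_norm, Complex.normSq_apply,
      Complex.normSq_apply, Complex.normSq_apply, h1, h2]
    simp [f, co]
    ring
  have hfin : ∃ ε > (0:ℝ), ∀ j, ‖co (pts j) - co (pts i)‖ < ε → co (pts j) = co (pts i) := by
    have : ∀ᶠ ε in nhdsWithin (0:ℝ) (Set.Ioi 0), ∀ j,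
        ‖co (pts j) - co (pts i)‖ < ε → co (pts j) = co (pts i) := by
      rw [Filter.eventually_all]
      intro j
      by_cases h : co (pts j) = co (pts i)
      · exact Filter.Eventually.of_forall fun _ _ => h
      · have hp : 0 < ‖co (pts j) - co (pts i)‖ := norm_pos_iff.2 (sub_ne_zero.2 h)
        filter_upwards [nhdsWithin_le_nhds (gt_mem_nhds hp)] with ε h1 h2
        exact absurd h2 (not_lt.2 (le_of_lt h1))
    obtain ⟨ε, h1, h2⟩ := (this.and self_mem_nhdsWithin).exists
    exact ⟨ε, h2, h1⟩
  obtain ⟨ε, hε, hsep⟩ := hfin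
  obtain ⟨N, r, hr, hN⟩ := lojasiewicz f (co (pts i)) ε hε (by
    intro v hv hv0
    obtain ⟨x, rfl⟩ := co_surj v
    rw [hf] at hv0
    have h1 : (‖x.1‖ ^ 2 + ‖x.2‖ ^ 2 - 1) ^ 2 = 0 := by
      nlinarith [sq_nonneg ‖eval ![x.1, x.2] p‖, sq_nonneg (‖x.1‖ ^ 2 + ‖x.2‖ ^ 2 - 1)]
    have h2 : ‖eval ![x.1, x.2] p‖ ^ 2 = 0 := by linarith
    have h3 : ‖x.1‖ ^ 2 + ‖x.2‖ ^ 2 = 1 := by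
      have := pow_eq_zero_iff (two_ne_zero) |>.1 h1
      linarith
    have h4 : eval ![x.1, x.2] p = 0 := norm_eq_zero.1 (pow_eq_zero_iff (two_ne_zero) |>.1 h2)
    obtain ⟨j, hj⟩ := (hzero x.1 x.2 h3).1 h4
    have hj : x = pts j := hj
    subst hj
    exact hsep j hv)
  refine ⟨N, r, hr, fun x hx hxr => ?_⟩
  have := hN (co x) hxr
  have hx : ‖x.1‖ ^ 2 + ‖x.2‖ ^ 2 = 1 := hx
  rw [hf, hx] at this
  simpa using this

end Loja

open Loja in
/-- Łojasiewicz-type lower bound: if `p ∈ ℂ[z,w]` vanishes on the unit sphere `𝕊₂` exactly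
at finitely many points `(ζᵢ,ηᵢ)`, then there are `c > 0` and `q ∈ ℕ` with
`|p(ζ,η)| ≥ c ∏ᵢ |1 - ζ ζ̄ᵢ - η η̄ᵢ|^q` on `𝕊₂`. -/
theorem stmt_11 (p : MvPolynomial (Fin 2) ℂ) (n : ℕ) (pts : Fin n → ℂ × ℂ)
    (hpts : ∀ i, ‖(pts i).1‖ ^ 2 + ‖(pts i).2‖ ^ 2 = 1)
    (hzero : ∀ ζ η : ℂ, ‖ζ‖ ^ 2 + ‖η‖ ^ 2 = 1 →
      (eval ![ζ, η] p = 0 ↔ ∃ i, (ζ, η) = pts i)) :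
    ∃ c > (0:ℝ), ∃ q : ℕ, ∀ ζ η : ℂ, ‖ζ‖ ^ 2 + ‖η‖ ^ 2 = 1 →
      c * ∏ i, ‖1 - ζ * (starRingEnd ℂ) (pts i).1 - η * (starRingEnd ℂ) (pts i).2‖ ^ q
        ≤ ‖eval ![ζ, η] p‖ := by
  choose N r hr hN using local_bound p n pts hzero
  let q : ℕ := ∑ i, N i
  have hNq : ∀ i, N i ≤ q := fun i => Finset.single_le_sum (fun _ _ => Nat.zero_le _) (Finset.mem_univ i)
  let g : ℂ × ℂ → ℝ := fun x => ∏ i, fac x (pts i) ^ q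
  have hfac0 : ∀ x y, 0 ≤ fac x y := fun x y => norm_nonneg _
  have hg0 : ∀ x, 0 ≤ g x := fun x => Finset.prod_nonneg fun i _ => pow_nonneg (hfac0 _ _) _
  have hcont : Continuous fun x : ℂ × ℂ => ‖eval ![x.1, x.2] p‖ := by
    have h1 : Continuous fun x : ℂ × ℂ => ![x.1, x.2] := by
      refine continuous_pi fun i => ?_
      fin_cases i
      · exact continuous_fst
      · exact continuous_snd
    exact ((MvPolynomial.continuous_eval p).comp h1).norm
  have hsub : ∀ s : Finset (Fin n), ∀ x ∈ Sph, ∏ i ∈ s, fac x (pts i) ^ q ≤ (4 ^ q) ^ n := by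
    intro s x hx
    calc ∏ i ∈ s, fac x (pts i) ^ q ≤ ∏ i ∈ s, (4:ℝ) ^ q :=
          Finset.prod_le_prod (fun i _ => pow_nonneg (hfac0 _ _) _) fun i _ =>
            pow_le_pow_left₀ (hfac0 _ _) (fac_le_four x (pts i) hx (hpts i)) _
      _ = (4 ^ q) ^ s.card := by simp
      _ ≤ (4 ^ q) ^ n := by
        apply pow_le_pow_right₀
        · exact one_le_pow₀ (by norm_num)
        · simpa using Finset.card_le_univ s
  have main : ∃ c > (0:ℝ), ∀ x ∈ Sph, c * g x ≤ ‖eval ![x.1, x.2] p‖ := by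
    refine compact_Sph.induction_on
      (p := fun S => ∃ c > (0:ℝ), ∀ x ∈ S, c * g x ≤ ‖eval ![x.1, x.2] p‖) ?_ ?_ ?_ ?_
    · exact ⟨1, one_pos, fun x hx => absurd hx (Set.notMem_empty x)⟩
    · rintro s t hst ⟨c, hc, h⟩
      exact ⟨c, hc, fun x hx => h x (hst hx)⟩
    · rintro s t ⟨c, hc, h⟩ ⟨c', hc', h'⟩
      refine ⟨min c c', lt_min hc hc', ?_⟩
      rintro x (hx | hx)
      · exact (mul_le_mul_of_nonneg_right (min_le_left _ _) (hg0 x)).trans (h x hx)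
      · exact (mul_le_mul_of_nonneg_right (min_le_right _ _) (hg0 x)).trans (h' x hx)
    · intro y hy
      by_cases hpy : eval ![y.1, y.2] p = 0
      · obtain ⟨i, hi⟩ := (hzero y.1 y.2 hy).1 hpy
        have hi : y = pts i := hi
        refine ⟨Metric.ball y (min (r i) 1) ∩ Sph, ?_, 1 / (4 ^ q * (4 ^ q) ^ n), by positivity, ?_⟩
        · rw [Set.inter_comm]
          exact inter_mem_nhdsWithin _ (Metric.ball_mem_nhds _ (lt_min (hr i) one_pos))
        · rintro x ⟨hxb, hx⟩
          rw [mem_ball_iff_norm, hi] at hxb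
          have hco := co_le_norm x (pts i)
          have hd1 : ‖co x - co (pts i)‖ < r i := by
            exact hco.trans_lt (hxb.trans_le (min_le_left _ _))
          have hd2 : ‖co x - co (pts i)‖ ≤ 1 := by
            exact (hco.trans_lt (hxb.trans_le (min_le_right _ _))).le
          have h1 := hN i x hx hd1
          have h2 : (‖co x - co (pts i)‖ ^ q) ^ 2 ≤ ‖eval ![x.1, x.2] p‖ ^ 2 := by
            refine le_trans ?_ h1
            rw [← pow_mul]
            exact pow_le_pow_of_le_one (norm_nonneg _) hd2 (by have := hNq i; omega)
          have h3 : ‖co x - co (pts i)‖ ^ q ≤ ‖eval ![x.1, x.2] p‖ :=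
            (pow_le_pow_iff_left₀ (by positivity) (norm_nonneg _) two_ne_zero).1 h2
          have h4 : fac x (pts i) ≤ 4 * ‖co x - co (pts i)‖ := by
            have := fac_le x (pts i) (hpts i)
            have := norm_le_co x (pts i)
            linarith [this.1, this.2]
          have h5 : fac x (pts i) ^ q ≤ 4 ^ q * ‖eval ![x.1, x.2] p‖ := by
            calc fac x (pts i) ^ q ≤ (4 * ‖co x - co (pts i)‖) ^ q :=
                  pow_le_pow_left₀ (hfac0 _ _) h4 _
              _ = 4 ^ q * ‖co x - co (pts i)‖ ^ q := mul_pow _ _ _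
              _ ≤ _ := by gcongr
          have h6 : g x ≤ (4 ^ q * ‖eval ![x.1, x.2] p‖) * (4 ^ q) ^ n := by
            change ∏ i, fac x (pts i) ^ q ≤ _
            rw [← Finset.mul_prod_erase Finset.univ _ (Finset.mem_univ i)]
            exact mul_le_mul h5 (hsub _ x hx)
              (Finset.prod_nonneg fun i _ => pow_nonneg (hfac0 _ _) _) (by positivity)
          rw [one_div, inv_mul_le_iff₀ (by positivity)]
          linarith
      · have hpos : 0 < ‖eval ![y.1, y.2] p‖ := norm_pos_iff.2 hpy
        refine ⟨{x | ‖eval ![y.1, y.2] p‖ / 2 < ‖eval ![x.1, x.2] p‖} ∩ Sph, ?_,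
          ‖eval ![y.1, y.2] p‖ / 2 / (4 ^ q) ^ n, by positivity, ?_⟩
        · rw [Set.inter_comm]
          apply inter_mem_nhdsWithin
          exact hcont.continuousAt.eventually (lt_mem_nhds (by linarith))
        · rintro x ⟨hx1, hx⟩
          have hx1 : ‖eval ![y.1, y.2] p‖ / 2 < ‖eval ![x.1, x.2] p‖ := hx1
          have := hsub Finset.univ x hx
          calc ‖eval ![y.1, y.2] p‖ / 2 / (4 ^ q) ^ n * g x
              ≤ ‖eval ![y.1, y.2] p‖ / 2 / (4 ^ q) ^ n * (4 ^ q) ^ n := by gcongr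
            _ = ‖eval ![y.1, y.2] p‖ / 2 := by field_simp
            _ ≤ _ := hx1.le
  obtain ⟨c, hc, h⟩ := main
  exact ⟨c, hc, q, fun ζ η hζ => h (ζ, η) hζ⟩
end

section
/- Let p ∈ ℂ[z,w] be non-vanishing on the open unit ball 𝔹₂, let P = (0,1) ∈ 𝕊₂ be a boundary zero of p. Then there exist ε > 0, a non-vanishing holomorphic function α on the disc 𝔻(0,ε), an integer n ≥ 1, and branches h₁, …, hₙ of algebraic functions on 𝔻(0,ε) (single-valued on a slit disc) such that p(z,w) = α(z)·∏_{j=1}^n (1 − h_j(z) w) for all (z,w) ∈ 𝔻(0,ε) × 𝔻(1,ε), and each h_j satisfies |h_j(z)|² ≤ 1/(1−|z|²). -/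
open Metric MvPolynomial

theorem localHomeo19 (f : ℂ × ℂ → ℂ) (hf : ContDiff ℂ 1 f) (z t : ℂ)
    (hd : deriv (fun s => f (z, s)) t ≠ 0) :
    ∃ φ : OpenPartialHomeomorph (ℂ × ℂ) (ℂ × ℂ), (z, t) ∈ φ.source ∧
      (∀ x, φ x = (x.1, f x)) ∧ DifferentiableAt ℂ φ.symm (φ (z, t)) := by
  have h1 : HasStrictFDerivAt f (fderiv ℂ f (z, t)) (z, t) :=
    hf.contDiffAt.hasStrictFDerivAt (by norm_num)
  have h2 : HasStrictFDerivAt (fun x : ℂ × ℂ => (x.1, f x))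
      ((ContinuousLinearMap.fst ℂ ℂ ℂ).prod (fderiv ℂ f (z, t))) (z, t) :=
    hasStrictFDerivAt_fst.prodMk h1
  have h3 : fderiv ℂ f (z, t) (0, 1) ≠ 0 := by
    have : HasDerivAt (fun s => f (z, s)) (fderiv ℂ f (z, t) (0, 1)) t := by
      have h4 : HasDerivAt (fun s : ℂ => (z, s)) ((0 : ℂ), (1 : ℂ)) t :=
        (hasDerivAt_const t z).prodMk (hasDerivAt_id t)
      exact h1.hasFDerivAt.comp_hasDerivAt t h4
    rwa [this.deriv] at hd
  have hinj : Function.Injective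
      ((ContinuousLinearMap.fst ℂ ℂ ℂ).prod (fderiv ℂ f (z, t)) : ℂ × ℂ →ₗ[ℂ] ℂ × ℂ) := by
    rw [injective_iff_map_eq_zero]
    rintro ⟨a, b⟩ hab
    simp only [ContinuousLinearMap.coe_coe, ContinuousLinearMap.prod_apply,
      ContinuousLinearMap.coe_fst', Prod.mk_eq_zero] at hab
    obtain ⟨rfl, hb⟩ := hab
    have : ((0 : ℂ), b) = b • ((0 : ℂ), (1 : ℂ)) := by simp
    rw [this, map_smul, smul_eq_mul] at hb
    rcases mul_eq_zero.1 hb with h | h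
    · simp [h]
    · exact absurd h h3
  let e : (ℂ × ℂ) ≃L[ℂ] (ℂ × ℂ) := (LinearEquiv.ofInjectiveEndo _ hinj).toContinuousLinearEquiv
  have he : (e : ℂ × ℂ →L[ℂ] ℂ × ℂ) =
      (ContinuousLinearMap.fst ℂ ℂ ℂ).prod (fderiv ℂ f (z, t)) := by
    ext <;> rfl
  rw [← he] at h2
  refine ⟨h2.toOpenPartialHomeomorph _, h2.mem_toOpenPartialHomeomorph_source, fun x => rfl, ?_⟩
  exact h2.to_localInverse.hasFDerivAt.differentiableAt

theorem lift19 (S : Set ℂ) (hS : IsOpen S) (z0 : ℂ) (hz0 : z0 ∈ S) (hstar : StarConvex ℝ z0 S)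
    (f : ℂ × ℂ → ℂ) (hf : ContDiff ℂ 1 f) (R : ℝ)
    (hR : ∀ z ∈ S, ∀ t, f (z, t) = 0 → ‖t‖ ≤ R)
    (hd : ∀ z ∈ S, ∀ t, f (z, t) = 0 → deriv (fun s => f (z, s)) t ≠ 0)
    (hfin : ∀ z ∈ S, {t | f (z, t) = 0}.Finite) :
    ∃ g : {t // f (z0, t) = 0} → ℂ → ℂ, (∀ t, DifferentiableOn ℂ (g t) S) ∧
      (∀ t, ∀ z ∈ S, f (z, g t z) = 0) ∧
      ∀ z ∈ S, Function.Injective (fun t => g t z) ∧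
        ∀ s, f (z, s) = 0 → ∃ t, g t z = s := by
  classical
  let E : Type := {x : ℂ × ℂ // x.1 ∈ S ∧ f x = 0}
  let π : E → S := fun e => ⟨e.1.1, e.2.1⟩
  have hπc : Continuous π := by
    apply Continuous.subtype_mk
    exact continuous_fst.comp continuous_subtype_val
  have hclosed : IsClosedMap π := by
    intro C hC
    let K := closedBall (0 : ℂ) R
    have : CompactSpace K := isCompact_iff_compactSpace.1 (isCompact_closedBall _ _)
    let Z : Type := {y : S × K // f (y.1, y.2) = 0}
    have hZ : IsClosed {y : S × K | f (y.1, y.2) = 0} :=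
      isClosed_singleton.preimage (f := fun y : S × K => f (y.1, y.2))
        (hf.continuous.comp (by fun_prop))
    let ι : Z → E := fun y => ⟨(y.1.1, y.1.2), y.1.1.2, y.2⟩
    have hι : Continuous ι := by
      apply Continuous.subtype_mk
      fun_prop
    have h1 : IsClosed (Subtype.val '' (ι ⁻¹' C) : Set (S × K)) :=
      hZ.isClosedEmbedding_subtypeVal.isClosedMap _ (hC.preimage hι)
    have h2 := isClosedMap_fst_of_compactSpace _ h1
    convert h2 using 1
    ext z
    constructor
    · rintro ⟨e, he, rfl⟩
      have hK : e.1.2 ∈ K := by simpa [K] using hR _ e.2.1 e.1.2 e.2.2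
      exact ⟨(⟨e.1.1, e.2.1⟩, ⟨e.1.2, hK⟩), ⟨⟨(⟨e.1.1, e.2.1⟩, ⟨e.1.2, hK⟩), e.2.2⟩, he, rfl⟩, rfl⟩
    · rintro ⟨_, ⟨y, hy, rfl⟩, rfl⟩
      exact ⟨ι y, hy, rfl⟩
  have hloc : IsLocalHomeomorph π := by
    apply IsLocalHomeomorph.mk
    intro e0
    obtain ⟨φ, h1, h2, -⟩ := localHomeo19 f hf e0.1.1 e0.1.2 (hd _ e0.2.1 _ e0.2.2)
    have key : ∀ z : S, ((z : ℂ), (0 : ℂ)) ∈ φ.target →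
        (φ.symm ((z : ℂ), (0 : ℂ))).1 = z ∧ f (φ.symm ((z : ℂ), (0 : ℂ))) = 0 := by
      intro z hz
      have := φ.right_inv hz
      rw [h2] at this
      exact ⟨congrArg Prod.fst this, congrArg Prod.snd this⟩
    let inv : S → E := fun z => if h : ((z : ℂ), (0 : ℂ)) ∈ φ.target then
      ⟨φ.symm ((z : ℂ), (0 : ℂ)), by rw [(key z h).1]; exact z.2, (key z h).2⟩ else e0
    have hE : ∀ e : E, φ e.1 = ((π e : ℂ), (0 : ℂ)) := by
      intro e; rw [h2, e.2.2]
    refine ⟨{ toFun := π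
              invFun := inv
              source := {e | e.1 ∈ φ.source}
              target := {z | ((z : ℂ), (0 : ℂ)) ∈ φ.target}
              map_source' := ?_
              map_target' := ?_
              left_inv' := ?_
              right_inv' := ?_
              open_source := φ.open_source.preimage continuous_subtype_val
              open_target := φ.open_target.preimage (by fun_prop)
              continuousOn_toFun := hπc.continuousOn
              continuousOn_invFun := ?_ }, h1, fun x _ => rfl⟩
    · intro e he
      change ((π e : ℂ), (0 : ℂ)) ∈ φ.target
      rw [← hE]; exact φ.map_source he
    · intro z hz
      have hz' : ((z : ℂ), (0 : ℂ)) ∈ φ.target := hz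
      simp only [inv, hz', dif_pos, Set.mem_ofPred_eq]
      exact φ.map_target hz'
    · intro e he
      have hz' : ((π e : ℂ), (0 : ℂ)) ∈ φ.target := by
        rw [← hE]; exact φ.map_source he
      apply Subtype.ext
      simp only [inv, hz', dif_pos]
      rw [← hE]; exact φ.left_inv he
    · intro z hz
      have hz' : ((z : ℂ), (0 : ℂ)) ∈ φ.target := hz
      apply Subtype.ext
      simp only [inv, hz', dif_pos, π]
      exact (key z hz').1
    · apply (Topology.IsInducing.subtypeVal (t := {x : ℂ × ℂ | x.1 ∈ S ∧ f x = 0})).continuousOn_iff.2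
      have : ContinuousOn (fun z : S => φ.symm ((z : ℂ), (0 : ℂ)))
          {z : S | ((z : ℂ), (0 : ℂ)) ∈ φ.target} :=
        φ.continuousOn_symm.comp (by fun_prop) (fun z hz => hz)
      refine this.congr ?_
      intro z hz
      have hz' : ((z : ℂ), (0 : ℂ)) ∈ φ.target := hz
      simp only [inv, hz', dif_pos, Function.comp]
  have hfinE : ∀ z : S, (π ⁻¹' {z}).Finite := by
    intro z
    refine Set.Finite.of_finite_image (f := fun e : E => e.1.2)
      ((hfin z z.2).subset ?_) ?_
    · rintro _ ⟨e, he, rfl⟩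
      have : e.1.1 = z := congrArg Subtype.val he
      have h2 := e.2.2
      change f ((z : ℂ), e.1.2) = 0
      rw [← this]; exact h2
    · intro e he e' he' h
      have h1 : e.1.1 = z := congrArg Subtype.val he
      have h2 : e'.1.1 = z := congrArg Subtype.val he'
      exact Subtype.ext (Prod.ext (h1.trans h2.symm) h)
  have hcov : IsCoveringMap π := by
    rw [isCoveringMap_iff_isCoveringMapOn_univ]
    refine hclosed.isCoveringMapOn_of_isLocalHomeomorphOn (fun z _ => hfinE z) ?_
    exact hloc.isLocalHomeomorphOn
  have : ContractibleSpace S := hstar.contractibleSpace ⟨z0, hz0⟩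
  have : LocallyPathConnectedSpace S := hS.locallyPathConnectedSpace
  have hl : ∀ e : E, ∃ F : C(S, E), F (π e) = e ∧ π ∘ F = id := fun e => by
    obtain ⟨F, hF, -⟩ := hcov.existsUnique_continuousMap_lifts (ContinuousMap.id S) (π e) e rfl
    exact ⟨F, hF⟩
  have huniq : ∀ F G : C(S, E), π ∘ F = id → π ∘ G = id → ∀ z, F z = G z → F = G := by
    intro F G hF hG z h
    exact DFunLike.coe_injective
      (hcov.eq_of_comp_eq F.continuous G.continuous (hF.trans hG.symm) z h)
  choose! F hF1 hF2 using hl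
  have hfst : ∀ e z, (F e z).1.1 = z := fun e z => congrArg Subtype.val (congrFun (hF2 e) z)
  let b : {t // f (z0, t) = 0} → E := fun t => ⟨(z0, t.1), hz0, t.2⟩
  let g : {t // f (z0, t) = 0} → ℂ → ℂ := fun t z =>
    if h : z ∈ S then (F (b t) ⟨z, h⟩).1.2 else 0
  have hg : ∀ t, ∀ z (h : z ∈ S), g t z = (F (b t) ⟨z, h⟩).1.2 := by
    intro t z h; simp only [g, h, dif_pos]
  have hpt : ∀ t, ∀ z (h : z ∈ S), (F (b t) ⟨z, h⟩).1 = (z, g t z) := by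
    intro t z h
    exact Prod.ext (hfst _ _) (hg t z h).symm
  have hzero : ∀ t, ∀ z ∈ S, f (z, g t z) = 0 := by
    intro t z h
    rw [← hpt t z h]; exact (F (b t) ⟨z, h⟩).2.2
  have hcont : ∀ t, ContinuousOn (g t) S := by
    intro t
    rw [continuousOn_iff_continuous_domRestrict]
    have : S.domRestrict (g t) = fun z => (F (b t) z).1.2 := by
      ext z; exact hg t z z.2
    rw [this]
    exact continuous_snd.comp (continuous_subtype_val.comp (F (b t)).continuous)
  refine ⟨g, ?_, hzero, ?_⟩
  · intro t z hz
    obtain ⟨φ, h1, h2, h3⟩ := localHomeo19 f hf z (g t z) (hd _ hz _ (hzero t z hz))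
    have hca : ContinuousAt (g t) z := (hcont t).continuousAt (hS.mem_nhds hz)
    have hca2 : ContinuousAt (fun y => (y, g t y)) z := continuousAt_id.prodMk hca
    have hev : ∀ᶠ y in nhds z, (y, g t y) ∈ φ.source :=
      hca2.eventually (φ.open_source.mem_nhds h1)
    have heq : g t =ᶠ[nhds z] fun y => (φ.symm (y, 0)).2 := by
      filter_upwards [hev, hS.mem_nhds hz] with y hy hyS
      have := φ.left_inv hy
      rw [h2, hzero t y hyS] at this
      rw [this]
    rw [h2, hzero t z hz] at h3
    have h4 : DifferentiableAt ℂ (fun y : ℂ => φ.symm (y, 0)) z :=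
      DifferentiableAt.comp (g := φ.symm) (f := fun y : ℂ => (y, (0 : ℂ))) z h3 (by fun_prop)
    exact (heq.differentiableAt_iff.2 h4.snd).differentiableWithinAt
  · intro z hz
    constructor
    · intro t t' h
      have h' : F (b t) ⟨z, hz⟩ = F (b t') ⟨z, hz⟩ := by
        apply Subtype.ext
        rw [hpt, hpt]
        exact Prod.ext rfl h
      have h3 := huniq _ _ (hF2 _) (hF2 _) _ h'
      have h4 := hF1 (b t)
      have h5 := hF1 (b t')
      have h6 : π (b t) = π (b t') := rfl
      rw [h3, h6, h5] at h4
      exact Subtype.ext (congrArg (fun e : E => e.1.2) h4).symm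
    · intro s hs
      let e : E := ⟨(z, s), hz, hs⟩
      let e' := F e ⟨z0, hz0⟩
      have h0 : e'.1.1 = z0 := hfst e ⟨z0, hz0⟩
      have ht : f (z0, e'.1.2) = 0 := by
        rw [← h0]; exact e'.2.2
      refine ⟨⟨e'.1.2, ht⟩, ?_⟩
      have hb : b ⟨e'.1.2, ht⟩ = e' := Subtype.ext (Prod.ext h0.symm rfl)
      have h7 : F (b ⟨e'.1.2, ht⟩) = F e := by
        refine huniq _ _ (hF2 _) (hF2 _) ⟨z0, hz0⟩ ?_
        have := hF1 (b ⟨e'.1.2, ht⟩)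
        have h8 : π (b ⟨e'.1.2, ht⟩) = ⟨z0, hz0⟩ := rfl
        rw [h8] at this
        rw [this, hb]
      rw [hg _ z hz, h7]
      have h9 : F e ⟨z, hz⟩ = e := hF1 e
      rw [h9]

abbrev slit19 (ε : ℝ) : Set ℂ := ball 0 ε \ {z : ℂ | z.im = 0 ∧ z.re ≤ 0}

theorem slit19_eq (ε : ℝ) : slit19 ε = ball 0 ε ∩ Complex.slitPlane := by
  ext z
  simp only [slit19, Set.mem_sdiff, Set.mem_inter_iff, Complex.mem_slitPlane_iff,
    Set.mem_ofPred_eq, not_and, not_le]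
  refine and_congr_right fun _ => ?_
  tauto

theorem slit19_mono {ε δ : ℝ} (h : ε ≤ δ) : slit19 ε ⊆ slit19 δ :=
  Set.sdiff_subset_sdiff_left (ball_subset_ball h)

/-- specialization of the first variable -/
noncomputable abbrev sp19 (z : ℂ) (P : Polynomial (Polynomial ℂ)) : Polynomial ℂ :=
  P.map (Polynomial.evalRingHom z)

theorem sep19 (P : Polynomial (Polynomial ℂ)) (hP : Irreducible P) (hdeg : P.natDegree ≠ 0) :
    ∃ D : Polynomial ℂ, D ≠ 0 ∧ ∀ z, D.eval z ≠ 0 → ∀ t, (sp19 z P).eval t = 0 →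
      (sp19 z P).derivative.eval t ≠ 0 := by
  have hprim := hP.isPrimitive hdeg
  let K := RatFunc ℂ
  have hirr : Irreducible (P.map (algebraMap (Polynomial ℂ) K)) :=
    hprim.irreducible_iff_irreducible_map_fraction_map.1 hP
  obtain ⟨u, v, huv⟩ := hirr.separable
  obtain ⟨b, hb⟩ := IsLocalization.integerNormalization_map_to_map
    (nonZeroDivisors (Polynomial ℂ)) u
  obtain ⟨c, hc⟩ := IsLocalization.integerNormalization_map_to_map
    (nonZeroDivisors (Polynomial ℂ)) v
  set A := IsLocalization.integerNormalization (nonZeroDivisors (Polynomial ℂ)) u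
  set B := IsLocalization.integerNormalization (nonZeroDivisors (Polynomial ℂ)) v
  have hinj : Function.Injective (Polynomial.map (algebraMap (Polynomial ℂ) K)) :=
    Polynomial.map_injective _ (IsFractionRing.injective _ _)
  have key : Polynomial.C (c : Polynomial ℂ) * A * P
      + Polynomial.C (b : Polynomial ℂ) * B * P.derivative
      = Polynomial.C ((b : Polynomial ℂ) * c) := by
    apply hinj
    simp only [Polynomial.map_add, Polynomial.map_mul, Polynomial.map_C, map_mul]
    rw [hb, hc, ← Polynomial.derivative_map, Algebra.smul_def, Algebra.smul_def]
    have hC : ∀ x : Polynomial ℂ, algebraMap (Polynomial ℂ) (Polynomial K) x =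
      Polynomial.C (algebraMap (Polynomial ℂ) K x) := fun x => rfl
    rw [hC, hC]
    linear_combination (Polynomial.C (algebraMap (Polynomial ℂ) K b) *
      Polynomial.C (algebraMap (Polynomial ℂ) K c)) * huv
  refine ⟨(b : Polynomial ℂ) * c, mul_ne_zero (nonZeroDivisors.ne_zero b.2)
    (nonZeroDivisors.ne_zero c.2), ?_⟩
  intro z hz t ht ht'
  apply hz
  have h := congrArg (fun Q => (sp19 z Q).eval t) key
  simp only [sp19, Polynomial.map_add, Polynomial.map_mul, Polynomial.map_C,
    Polynomial.eval_add, Polynomial.eval_mul, Polynomial.eval_C, ← Polynomial.derivative_map] at h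
  simp only [sp19] at ht ht'
  rw [ht, ht'] at h
  simpa using h.symm

theorem sp19_contDiff (P : Polynomial (Polynomial ℂ)) :
    ContDiff ℂ 1 (fun x : ℂ × ℂ => (sp19 x.1 P).eval x.2) := by
  have : (fun x : ℂ × ℂ => (sp19 x.1 P).eval x.2) =
      fun x => ∑ i ∈ Finset.range (P.natDegree + 1), (P.coeff i).eval x.1 * x.2 ^ i := by
    ext x
    rw [sp19, Polynomial.eval_map, Polynomial.eval₂_eq_sum_range]
    rfl
  rw [this]
  refine ContDiff.sum fun i _ => ContDiff.mul ?_ (contDiff_snd.pow i)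
  have h : ContDiff ℂ 1 (fun z : ℂ => Polynomial.aeval z (P.coeff i)) :=
    Polynomial.contDiff_aeval _ _
  simp only [Polynomial.coe_aeval_eq_eval] at h
  exact h.comp contDiff_fst

def good19 (P : Polynomial (Polynomial ℂ)) : Prop :=
  ∃ ε > (0 : ℝ), ε ≤ 1 / 2 ∧ ∃ L : List (ℂ → ℂ), (∀ g ∈ L, DifferentiableOn ℂ g (slit19 ε)) ∧
    ∀ z ∈ slit19 ε, sp19 z P = Polynomial.C (P.leadingCoeff.eval z) *
      (L.map (fun g => Polynomial.X - Polynomial.C (g z))).prod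

def hyp19 (P : Polynomial (Polynomial ℂ)) : Prop :=
  ∀ z ∈ ball (0 : ℂ) (1 / 2), P.leadingCoeff.eval z ≠ 0 ∧
    ∀ t, (sp19 z P).eval t = 0 → ‖t‖ ≤ 2

theorem good19_deg0 (P : Polynomial (Polynomial ℂ)) (h : P.natDegree = 0) : good19 P := by
  rw [Polynomial.natDegree_eq_zero] at h
  obtain ⟨c, rfl⟩ := h
  exact ⟨1 / 2, by norm_num, le_rfl, [], by simp, by simp [sp19]⟩

theorem good19_irr (P : Polynomial (Polynomial ℂ)) (hP : Irreducible P) (hh : hyp19 P) :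
    good19 P := by
  classical
  by_cases hdeg : P.natDegree = 0
  · exact good19_deg0 P hdeg
  obtain ⟨D, hD0, hD⟩ := sep19 P hP hdeg
  have : ∃ ε > (0 : ℝ), ε ≤ 1 / 2 ∧ ∀ z ∈ ball (0 : ℂ) ε, z ≠ 0 → D.eval z ≠ 0 := by
    have hfin : ({z | D.eval z = 0} \ {0} : Set ℂ).Finite := by
      refine (D.roots.toFinset.finite_toSet.subset ?_).subset Set.sdiff_subset
      intro z hz
      simpa [hD0] using hz
    have hn := hfin.isClosed.isOpen_compl.mem_nhds (x := (0 : ℂ)) (by simp)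
    obtain ⟨ε, hε, hsub⟩ := Metric.mem_nhds_iff.1 hn
    refine ⟨min ε (1 / 2), by positivity, min_le_right _ _, fun z hz hz0 hDz => ?_⟩
    exact hsub (ball_subset_ball (min_le_left _ _) hz) ⟨hDz, hz0⟩
  obtain ⟨ε, hε, hε2, hDε⟩ := this
  have hsl : ∀ z ∈ slit19 ε, z ∈ ball (0 : ℂ) (1 / 2) :=
    fun z hz => ball_subset_ball hε2 hz.1
  have hsl0 : ∀ z ∈ slit19 ε, z ≠ 0 := by
    rintro z hz rfl
    exact hz.2 ⟨rfl, le_rfl⟩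
  have hopen : IsOpen (slit19 ε) := by
    rw [slit19_eq]; exact isOpen_ball.inter Complex.isOpen_slitPlane
  have hz0b : (((ε / 2 : ℝ)) : ℂ) ∈ ball (0 : ℂ) ε := by
    rw [mem_ball_zero_iff, Complex.norm_real, Real.norm_of_nonneg (by positivity)]
    linarith
  have hz0 : (((ε / 2 : ℝ)) : ℂ) ∈ slit19 ε := by
    refine ⟨hz0b, ?_⟩
    rintro ⟨-, h⟩
    rw [Complex.ofReal_re] at h
    linarith
  have hstar : StarConvex ℝ (((ε / 2 : ℝ)) : ℂ) (slit19 ε) := by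
    rw [slit19_eq]
    exact ((convex_ball _ _).starConvex hz0b).inter
      (Complex.starConvex_ofReal_slitPlane (by positivity))
  have hne : ∀ z ∈ slit19 ε, sp19 z P ≠ 0 := by
    intro z hz h
    have h1 := congrArg (fun Q => Polynomial.coeff Q P.natDegree) h
    simp only [sp19, Polynomial.coeff_map, Polynomial.coeff_zero] at h1
    exact (hh z (hsl z hz)).1 h1
  have hfin : ∀ z ∈ slit19 ε, {t | (sp19 z P).eval t = 0}.Finite := by
    intro z hz
    refine (sp19 z P).roots.toFinset.finite_toSet.subset ?_
    intro t ht
    simpa [hne z hz] using ht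
  have hder : ∀ z ∈ slit19 ε, ∀ t, (sp19 z P).eval t = 0 → (sp19 z P).derivative.eval t ≠ 0 :=
    fun z hz => hD z (hDε z hz.1 (hsl0 z hz))
  obtain ⟨g, hg1, hg2, hg3⟩ := lift19 (slit19 ε) hopen _ hz0 hstar
    (fun x : ℂ × ℂ => (sp19 x.1 P).eval x.2) (sp19_contDiff P) 2
    (fun z hz t ht => (hh z (hsl z hz)).2 t ht)
    (fun z hz t ht => by
      have := hder z hz t ht
      rwa [← Polynomial.deriv] at this)
    hfin
  have : Fintype {t // (sp19 (((ε / 2 : ℝ)) : ℂ) P).eval t = 0} := (hfin _ hz0).fintype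
  refine ⟨ε, hε, hε2, Finset.univ.toList.map g, ?_, ?_⟩
  · intro h hmem
    obtain ⟨t, -, rfl⟩ := List.mem_map.1 hmem
    exact hg1 t
  · intro z hz
    have hsplit := (IsAlgClosed.splits (sp19 z P)).eq_prod_roots
    have hlc : (sp19 z P).leadingCoeff = P.leadingCoeff.eval z :=
      Polynomial.leadingCoeff_map_of_leadingCoeff_ne_zero _ (hh z (hsl z hz)).1
    have hnodup : (sp19 z P).roots.Nodup := by
      rw [Multiset.nodup_iff_count_le_one]
      intro t
      rw [Polynomial.count_roots]
      by_contra hcon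
      push Not at hcon
      have := (Polynomial.one_lt_rootMultiplicity_iff_isRoot (hne z hz)).1 hcon
      exact hder z hz t this.1 this.2
    have hroots : (sp19 z P).roots = (Finset.univ.val.map (fun t => g t z)) := by
      refine (Multiset.Nodup.ext hnodup (Finset.univ.nodup.map (hg3 z hz).1)).2 fun t => ?_
      rw [Polynomial.mem_roots (hne z hz), Multiset.mem_map]
      constructor
      · intro h
        obtain ⟨s, hs⟩ := (hg3 z hz).2 t h
        exact ⟨s, Finset.mem_univ _, hs⟩
      · rintro ⟨s, -, rfl⟩
        exact hg2 s z hz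
    rw [hlc, hroots] at hsplit
    rw [hsplit]
    congr 1
    rw [Multiset.map_map, List.map_map]
    change _ = (List.map (fun t => Polynomial.X - Polynomial.C (g t z)) Finset.univ.toList).prod
    rw [Finset.prod_map_toList]
    rfl

theorem good19_all (P : Polynomial (Polynomial ℂ)) : hyp19 P → good19 P := by
  induction P using WfDvdMonoid.induction_on_irreducible with
  | zero => intro _; exact good19_deg0 _ (by simp)
  | unit u hu => intro _; exact good19_deg0 _ (Polynomial.natDegree_eq_zero_of_isUnit hu)
  | mul a i ha hi ih =>
    intro h
    have h1 : hyp19 i := by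
      intro z hz
      have := h z hz
      rw [Polynomial.leadingCoeff_mul, Polynomial.eval_mul] at this
      refine ⟨left_ne_zero_of_mul this.1, fun t ht => this.2 t ?_⟩
      simp only [sp19] at ht
      simp [sp19, ht]
    have h2 : hyp19 a := by
      intro z hz
      have := h z hz
      rw [Polynomial.leadingCoeff_mul, Polynomial.eval_mul] at this
      refine ⟨right_ne_zero_of_mul this.1, fun t ht => this.2 t ?_⟩
      simp only [sp19] at ht
      simp [sp19, ht]
    obtain ⟨ε, hε, hε2, L, hL, hL'⟩ := good19_irr i hi h1
    obtain ⟨δ, hδ, hδ2, M, hM, hM'⟩ := ih h2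
    refine ⟨min ε δ, lt_min hε hδ, (min_le_left _ _).trans hε2, L ++ M, ?_, ?_⟩
    · intro g hg
      rcases List.mem_append.1 hg with hg | hg
      · exact (hL g hg).mono (slit19_mono (min_le_left _ _))
      · exact (hM g hg).mono (slit19_mono (min_le_right _ _))
    · intro z hz
      have e1 := hL' z (slit19_mono (min_le_left _ _) hz)
      have e2 := hM' z (slit19_mono (min_le_right _ _) hz)
      have : sp19 z (i * a) = sp19 z i * sp19 z a := Polynomial.map_mul _
      rw [this, e1, e2, Polynomial.leadingCoeff_mul, Polynomial.eval_mul, List.map_append,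
        List.prod_append, Polynomial.C_mul]
      ring

theorem stmt_19 (p : MvPolynomial (Fin 2) ℂ)
    (hnv : ∀ z w : ℂ, ‖z‖ ^ 2 + ‖w‖ ^ 2 < 1 → eval ![z, w] p ≠ 0)
    (hP : eval ![0, 1] p = 0) :
    ∃ ε > (0:ℝ), ∃ a : ℂ → ℂ, ∃ n : ℕ, 1 ≤ n ∧ ∃ h : Fin n → ℂ → ℂ,
      DifferentiableOn ℂ a (ball 0 ε) ∧
      (∀ z ∈ ball (0:ℂ) ε, a z ≠ 0) ∧
      (∀ j : Fin n, DifferentiableOn ℂ (h j)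
        (ball 0 ε \ {z : ℂ | z.im = 0 ∧ z.re ≤ 0})) ∧
      (∀ z ∈ ball (0:ℂ) ε \ {z : ℂ | z.im = 0 ∧ z.re ≤ 0},
        ∀ w ∈ ball (1:ℂ) ε,
          eval ![z, w] p = a z * ∏ j : Fin n, (1 - h j z * w)) ∧
      (∀ j : Fin n, ∀ z ∈ ball (0:ℂ) ε \ {z : ℂ | z.im = 0 ∧ z.re ≤ 0},
        ‖h j z‖ ^ 2 ≤ 1 / (1 - ‖z‖ ^ 2)) := by
  classical
  let P : Polynomial (Polynomial ℂ) :=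
    MvPolynomial.aeval ![Polynomial.C Polynomial.X, Polynomial.X] p
  have hev : ∀ z w, (sp19 z P).eval w = eval ![z, w] p := by
    intro z w
    have : ((Polynomial.evalRingHom w).comp ((Polynomial.mapRingHom (Polynomial.evalRingHom z)).comp
        (MvPolynomial.aeval (R := ℂ) ![Polynomial.C (Polynomial.X : Polynomial ℂ),
          Polynomial.X]).toRingHom)) = eval ![z, w] := by
      apply MvPolynomial.ringHom_ext
      · intro r
        simp [Polynomial.algebraMap_def]
      · intro i
        fin_cases i <;> simp
    exact congrArg (fun F => F p) this
  have hc0 : ∀ z ∈ ball (0 : ℂ) 1, (P.coeff 0).eval z ≠ 0 := by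
    intro z hz
    have h1 := hnv z 0 (by
      rw [mem_ball_zero_iff] at hz
      have := norm_nonneg z
      simp only [norm_zero]
      nlinarith)
    rw [← hev, ← Polynomial.coeff_zero_eq_eval_zero, Polynomial.coeff_map] at h1
    exact h1
  have hc00 : P.coeff 0 ≠ 0 := by
    intro h
    apply hc0 0 (by simp)
    simp [h]
  have hlc : P.reverse.leadingCoeff = P.coeff 0 := by
    rw [Polynomial.reverse_leadingCoeff, Polynomial.trailingCoeff,
      Polynomial.natTrailingDegree_eq_zero.2 (Or.inr hc00)]
  have hdeg : P.reverse.natDegree = P.natDegree := by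
    rw [Polynomial.reverse_natDegree, Polynomial.natTrailingDegree_eq_zero.2 (Or.inr hc00),
      Nat.sub_zero]
  have hrev : ∀ z w : ℂ, w ≠ 0 →
      (sp19 z P.reverse).eval w⁻¹ * w ^ P.natDegree = eval ![z, w] p := by
    intro z w hw
    rw [← hev]
    let _ : Invertible w := invertibleOfNonzero hw
    have := Polynomial.eval₂_reverse_mul_pow (Polynomial.evalRingHom z) w P
    rw [invOf_eq_inv] at this
    simpa only [sp19, Polynomial.eval_map] using this
  have hbound : ∀ z ∈ ball (0 : ℂ) 1, ∀ t, (sp19 z P.reverse).eval t = 0 →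
      ‖t‖ ^ 2 ≤ 1 / (1 - ‖z‖ ^ 2) := by
    intro z hz t ht
    rw [mem_ball_zero_iff] at hz
    have hz1 : 0 < 1 - ‖z‖ ^ 2 := by
      have := norm_nonneg z
      nlinarith
    by_cases ht0 : t = 0
    · subst ht0
      have : 0 < 1 / (1 - ‖z‖ ^ 2) := one_div_pos.2 hz1
      simpa using this.le
    have h1 := hrev z t⁻¹ (inv_ne_zero ht0)
    rw [inv_inv, ht, zero_mul] at h1
    by_contra hcon
    push Not at hcon
    refine hnv z t⁻¹ ?_ h1.symm
    have htp : 0 < ‖t‖ ^ 2 := by positivity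
    rw [div_lt_iff₀ hz1] at hcon
    rw [norm_inv, inv_pow]
    have : (‖t‖ ^ 2)⁻¹ < 1 - ‖z‖ ^ 2 := by
      rw [inv_lt_iff_one_lt_mul₀ htp]
      linarith
    linarith
  have hyp : hyp19 P.reverse := by
    intro z hz
    have hz1 : z ∈ ball (0 : ℂ) 1 := ball_subset_ball (by norm_num) hz
    refine ⟨by rw [hlc]; exact hc0 z hz1, fun t ht => ?_⟩
    have h1 := hbound z hz1 t ht
    rw [mem_ball_zero_iff] at hz
    have hz2 : ‖z‖ ^ 2 ≤ 1 / 4 := by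
      have := norm_nonneg z
      nlinarith
    have h2 : 1 / (1 - ‖z‖ ^ 2) ≤ 4 := by
      rw [div_le_iff₀ (by linarith)]
      linarith
    have := norm_nonneg t
    nlinarith
  obtain ⟨ε, hε, hε2, L, hL, hL'⟩ := good19_all _ hyp
  have hball : ∀ z ∈ ball (0 : ℂ) ε, z ∈ ball (0 : ℂ) 1 :=
    fun z hz => ball_subset_ball (by linarith) hz
  have hz0 : (((ε / 2 : ℝ)) : ℂ) ∈ slit19 ε := by
    refine ⟨?_, ?_⟩
    · rw [mem_ball_zero_iff, Complex.norm_real, Real.norm_of_nonneg (by positivity)]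
      linarith
    rintro ⟨-, h⟩
    rw [Complex.ofReal_re] at h
    linarith
  have hlen : L.length = P.natDegree := by
    have hne := hc0 _ (hball _ hz0.1)
    have h1 := congrArg Polynomial.natDegree (hL' _ hz0)
    rw [hlc, Polynomial.natDegree_C_mul hne, Polynomial.natDegree_map_of_leadingCoeff_ne_zero _
      (by rw [hlc]; exact hne), hdeg] at h1
    rw [h1]
    have : (L.map (fun g => Polynomial.X - Polynomial.C (g (((ε / 2 : ℝ)) : ℂ)))) =
      (L.map (fun g => g (((ε / 2 : ℝ)) : ℂ))).map (fun a => Polynomial.X - Polynomial.C a) := by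
      rw [List.map_map]; rfl
    rw [this]
    have h2 := Polynomial.natDegree_multiset_prod_X_sub_C_eq_card
      ((L.map (fun g => g (((ε / 2 : ℝ)) : ℂ)) : List ℂ) : Multiset ℂ)
    rw [Multiset.map_coe, Multiset.prod_coe] at h2
    rw [h2]
    simp
  refine ⟨ε, hε, fun z => (P.coeff 0).eval z, L.length, ?_, fun j => L[j], ?_, ?_, ?_, ?_, ?_⟩
  · rw [hlen, Nat.one_le_iff_ne_zero]
    intro h0
    rw [Polynomial.natDegree_eq_zero] at h0
    obtain ⟨c, hc⟩ := h0
    rw [← hev, ← hc] at hP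
    have h1 := hc0 0 (by simp)
    rw [← hc] at h1
    simp only [sp19, Polynomial.map_C, Polynomial.eval_C, Polynomial.coeff_C_zero] at hP h1
    exact h1 hP
  · exact (P.coeff 0).differentiable.differentiableOn
  · exact fun z hz => hc0 z (hball z hz)
  · exact fun j => hL _ (List.getElem_mem _)
  · intro z hz w hw
    have hw0 : w ≠ 0 := by
      rintro rfl
      rw [mem_ball, dist_zero_left] at hw
      simp at hw
      linarith
    rw [← hrev z w hw0, hL' z hz, hlc, ← hlen, Polynomial.eval_mul, Polynomial.eval_C,
      Polynomial.eval_list_prod, List.map_map, mul_assoc]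
    congr 1
    have hF := Fin.prod_univ_fun_getElem L (fun g => 1 - g z * w)
    refine Eq.trans ?_ hF.symm
    clear hF hL hL' hlen
    induction L with
    | nil => simp
    | cons g M ih =>
      simp only [List.map_cons, List.prod_cons, List.length_cons, pow_succ, Function.comp_apply,
        Polynomial.eval_sub, Polynomial.eval_X, Polynomial.eval_C]
      rw [← ih]
      have : (1 : ℂ) - g z * w = (w⁻¹ - g z) * w := by
        rw [sub_mul, inv_mul_cancel₀ hw0]
      rw [this]
      ring
  · intro j z hz
    apply hbound z (hball z hz.1)
    rw [hL' z hz, Polynomial.eval_mul, Polynomial.eval_list_prod]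
    apply mul_eq_zero_of_right
    apply List.prod_eq_zero
    rw [List.map_map, List.mem_map]
    exact ⟨L[j], List.getElem_mem _, by simp⟩
end
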